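/- arXiv:1401.1225 — 4 statements merged into one kernel-verified Lean document; each statement's English description precedes it below -/
import Mathlib

section
/- Every finite poset of width at most 3 is d-decomposable. -/
/-- A *unichain* in the product of two posets: a chain of the form `{p} × C`
or `C × {q}`. -/
def IsUnichain {α β : Type*} [PartialOrder α] [PartialOrder β] (U : Set (α × β)) : Prop :=
  (∃ (p : α) (C : Set β), IsChain (· ≤ ·) C ∧ U = ({p} : Set α) ×ˢ C) ∨
  (∃ (q : β) (C : Set α), IsChain (· ≤ ·) C ∧ U = C ×ˢ ({q} : Set β))

/-- A *semiantichain*: no two distinct elements lie in a common unichain. -/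
def IsSemiantichain {α β : Type*} [PartialOrder α] [PartialOrder β] (S : Set (α × β)) : Prop :=
  ∀ x ∈ S, ∀ y ∈ S, x ≠ y → ∀ U : Set (α × β), IsUnichain U → ¬(x ∈ U ∧ y ∈ U)

/-- The maximum size of a semiantichain in `α × β`. -/
noncomputable def maxSemiantichain (α β : Type*) [PartialOrder α] [PartialOrder β] : ℕ :=
  sSup {n | ∃ S : Set (α × β), IsSemiantichain S ∧ S.ncard = n}

/-- The minimum number of unichains needed to cover `α × β`. -/
noncomputable def minUnichainCover (α β : Type*) [PartialOrder α] [PartialOrder β] : ℕ :=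
  sInf {n | ∃ U : Fin n → Set (α × β), (∀ i, IsUnichain (U i)) ∧ (⋃ i, U i) = Set.univ}

/-- Height: maximum size of a chain. -/
noncomputable def heightP (α : Type*) [PartialOrder α] : ℕ :=
  sSup {n | ∃ C : Set α, IsChain (· ≤ ·) C ∧ C.ncard = n}

/-- Width: maximum size of an antichain. -/
noncomputable def widthP (α : Type*) [PartialOrder α] : ℕ :=
  sSup {n | ∃ A : Set α, IsAntichain (· ≤ ·) A ∧ A.ncard = n}

/-- `dk α k`: maximum size of a union of `k` antichains. -/
noncomputable def dk (α : Type*) [PartialOrder α] (k : ℕ) : ℕ :=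
  sSup {n | ∃ A : Fin k → Set α, (∀ i, IsAntichain (· ≤ ·) (A i)) ∧ (⋃ i, A i).ncard = n}

/-- `ck α k`: maximum size of a union of `k` chains. -/
noncomputable def ck (α : Type*) [PartialOrder α] (k : ℕ) : ℕ :=
  sSup {n | ∃ C : Fin k → Set α, (∀ i, IsChain (· ≤ ·) (C i)) ∧ (⋃ i, C i).ncard = n}

/-- `P` is d-decomposable: it has an antichain partition `A_1, …, A_{h(P)}`
with `|A_1 ∪ … ∪ A_k| = d_k(P)` for every `k ≤ h(P)`. -/
def DDecomposable (α : Type*) [PartialOrder α] : Prop :=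
  ∃ A : Fin (heightP α) → Set α,
    (∀ i, IsAntichain (· ≤ ·) (A i)) ∧
    (∀ i j, i ≠ j → Disjoint (A i) (A j)) ∧
    (⋃ i, A i) = Set.univ ∧
    ∀ k, k ≤ heightP α →
      (⋃ i : Fin (heightP α), ⋃ (_ : (i : ℕ) < k), A i).ncard = dk α k

/-- `P` is c-decomposable: it has a chain partition `C_1, …, C_{w(P)}`
with `|C_1 ∪ … ∪ C_k| = c_k(P)` for every `k ≤ w(P)`. -/
def CDecomposable (α : Type*) [PartialOrder α] : Prop :=
  ∃ C : Fin (widthP α) → Set α,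
    (∀ i, IsChain (· ≤ ·) (C i)) ∧
    (∀ i j, i ≠ j → Disjoint (C i) (C j)) ∧
    (⋃ i, C i) = Set.univ ∧
    ∀ k, k ≤ widthP α →
      (⋃ i : Fin (widthP α), ⋃ (_ : (i : ℕ) < k), C i).ncard = ck α k

namespace DDec

/-- Minimal potentials have a tight simple path from source to sink. -/
lemma exists_potential {V : Type*} (Arc : V → ℤ → V → Prop) (s t : V) (f0 : V → ℤ)
    (hf0 : ∀ v c w, Arc v c w → f0 v + c ≤ f0 w) (h0 : f0 s = 0)
    (lb : ∀ f : V → ℤ, (∀ v c w, Arc v c w → f v + c ≤ f w) → f s = 0 → 0 ≤ f t) :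
    ∃ g : V → ℤ, (∀ v c w, Arc v c w → g v + c ≤ g w) ∧ g s = 0 ∧
      ∃ (n : ℕ) (p : ℕ → V), p 0 = s ∧ p n = t ∧
        (∀ i < n, ∃ c, Arc (p i) c (p (i+1)) ∧ g (p i) + c = g (p (i+1))) ∧
        ∀ i j, i < j → j ≤ n → p i ≠ p j := by
  classical
  have hex : ∃ m : ℕ, ∃ f : V → ℤ, (∀ v c w, Arc v c w → f v + c ≤ f w) ∧ f s = 0 ∧ f t = m :=
    ⟨(f0 t).toNat, f0, hf0, h0, (Int.toNat_of_nonneg (lb f0 hf0 h0)).symm⟩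
  obtain ⟨g, hg, hgs, hgt⟩ := Nat.find_spec hex
  refine ⟨g, hg, hgs, ?_⟩
  let S : V → Prop := fun v => ∃ (n : ℕ) (p : ℕ → V), p 0 = s ∧ p n = v ∧
        (∀ i < n, ∃ c, Arc (p i) c (p (i+1)) ∧ g (p i) + c = g (p (i+1)))
  have hSs : S s := ⟨0, fun _ => s, rfl, rfl, fun i hi => absurd hi (by omega)⟩
  have hstep : ∀ v c w, S v → Arc v c w → g v + c = g w → S w := by
    rintro v c w ⟨n, p, hp0, hpn, hp⟩ ha ht
    refine ⟨n+1, fun i => if i ≤ n then p i else w, by simp [hp0], by simp, ?_⟩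
    intro i hi
    rcases Nat.lt_or_ge i n with h | h
    · obtain ⟨c', h1, h2⟩ := hp i h
      refine ⟨c', ?_⟩
      have e1 : i ≤ n := by omega
      have e2 : i + 1 ≤ n := by omega
      simp only [e1, e2, if_true]
      exact ⟨h1, h2⟩
    · have e : i = n := by omega
      subst e
      refine ⟨c, ?_⟩
      simp [hpn, ha, ht]
  have hSt : S t := by
    by_contra hnt
    let g' : V → ℤ := fun v => if S v then g v else g v - 1
    have hg' : ∀ v c w, Arc v c w → g' v + c ≤ g' w := by
      intro v c w ha
      have h1 := hg v c w ha
      by_cases hv : S v <;> by_cases hw : S w <;> simp only [g', hv, hw, if_true, if_false]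
      · exact h1
      · have : g v + c ≠ g w := fun h => hw (hstep v c w hv ha h)
        omega
      · omega
      · omega
    have hgs' : g' s = 0 := by simp [g', hSs, hgs]
    have hgt' : g' t = g t - 1 := by simp [g', hnt]
    have h1 := lb g' hg' hgs'
    have h2 : Nat.find hex ≤ (g' t).toNat :=
      Nat.find_min' hex ⟨g', hg', hgs', (Int.toNat_of_nonneg h1).symm⟩
    omega
  have hSt' : ∃ n : ℕ, ∃ p : ℕ → V, p 0 = s ∧ p n = t ∧
        (∀ i < n, ∃ c, Arc (p i) c (p (i+1)) ∧ g (p i) + c = g (p (i+1))) := hSt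
  obtain ⟨p, hp0, hpn, hp⟩ := Nat.find_spec hSt'
  refine ⟨Nat.find hSt', p, hp0, hpn, hp, ?_⟩
  intro i j hij hj heq
  generalize hN : Nat.find hSt' = N at *
  have hmin := @Nat.find_min' _ _ hSt' (N - (j - i))
    ⟨fun k => if k ≤ i then p k else p (k + (j - i)), by simp [hp0], ?_, ?_⟩
  · omega
  · show (if N - (j-i) ≤ i then p (N - (j - i)) else p (N - (j-i) + (j - i))) = t
    have e : N - (j-i) + (j-i) = N := by omega
    split_ifs with h
    · have e1 : N - (j - i) = i := by omega
      have e2 : N = j := by omega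
      rw [e1, heq, ← e2, hpn]
    · rw [e, hpn]
  · intro k hk
    rcases lt_trichotomy k i with h | h | h
    · obtain ⟨c, h1⟩ := hp k (by omega)
      have e1 : k ≤ i := by omega
      have e2 : k + 1 ≤ i := by omega
      simp only [e1, e2, if_true]
      exact ⟨c, h1⟩
    · obtain ⟨c, h1⟩ := hp j (by omega)
      have e1 : k ≤ i := by omega
      have e2 : ¬ k + 1 ≤ i := by omega
      have e3 : k + 1 + (j - i) = j + 1 := by omega
      simp only [e1, e2, if_true, if_false, e3]
      rw [h, heq]
      exact ⟨c, h1⟩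
    · obtain ⟨c, h1⟩ := hp (k + (j - i)) (by omega)
      have e1 : ¬ k ≤ i := by omega
      have e2 : ¬ k + 1 ≤ i := by omega
      have e3 : k + 1 + (j - i) = k + (j - i) + 1 := by omega
      simp only [e1, e2, if_false, e3]
      exact ⟨c, h1⟩

/-- Nodes of the network. -/
inductive Nd (α : Type) : Type
  | s : Nd α
  | t : Nd α
  | lo : α → Nd α
  | hi : α → Nd α

/-- lower ends along the chain -/
def Lc {α : Type} (h : ℕ) (c : ℕ → α) (i : ℕ) : Nd α := if i < h then Nd.lo (c i) else Nd.t

/-- upper ends along the chain -/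
def Hc {α : Type} (c : ℕ → α) (i : ℕ) : Nd α :=
  match i with
  | 0 => Nd.s
  | i + 1 => Nd.hi (c i)

/-- Residual arcs. -/
inductive Arc {α : Type} [PartialOrder α] (h : ℕ) (c : ℕ → α) (C : Finset α) :
    Nd α → ℤ → Nd α → Prop
  | sx (x : α) : Arc h c C Nd.s 0 (Nd.lo x)
  | xt (x : α) : Arc h c C (Nd.hi x) 0 Nd.t
  | xy (x y : α) : x < y → Arc h c C (Nd.hi x) 0 (Nd.lo y)
  | up (x : α) : x ∉ C → Arc h c C (Nd.lo x) 1 (Nd.hi x)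
  | free (x : α) : Arc h c C (Nd.lo x) 0 (Nd.hi x)
  | down (x : α) : x ∈ C → Arc h c C (Nd.hi x) (-1) (Nd.lo x)
  | back (i : ℕ) : i ≤ h → Arc h c C (Lc h c i) 0 (Hc c i)

lemma telescope {α : Type} (h : ℕ) (c : ℕ → α) (F : Nd α → ℤ) :
    ∑ i ∈ Finset.range (h+1), (F (Lc h c i) - F (Hc c i)) =
      F Nd.t - F Nd.s - ∑ i ∈ Finset.range h, (F (Nd.hi (c i)) - F (Nd.lo (c i))) := by
  rw [Finset.sum_sub_distrib, Finset.sum_range_succ, Finset.sum_range_succ',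
    Finset.sum_sub_distrib]
  have : ∑ i ∈ Finset.range h, F (Lc h c i) = ∑ i ∈ Finset.range h, F (Nd.lo (c i)) := by
    apply Finset.sum_congr rfl
    intro i hi
    simp [Lc, Finset.mem_range.mp hi]
  rw [this]
  simp [Lc, Hc]
  ring

lemma chain_card_le {α : Type} [Fintype α] [PartialOrder α] (C : Finset α)
    (hC : IsChain (· ≤ ·) (C : Set α)) : C.card ≤ heightP α := by
  apply le_csSup
  · refine ⟨Nat.card α, ?_⟩
    rintro n ⟨S, -, rfl⟩
    exact Set.ncard_le_card S
  · exact ⟨C, hC, Set.ncard_coe_finset C⟩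

lemma antichain_card_le {α : Type} [Fintype α] [PartialOrder α] (C : Finset α)
    (hC : IsAntichain (· ≤ ·) (C : Set α)) : C.card ≤ widthP α := by
  apply le_csSup
  · refine ⟨Nat.card α, ?_⟩
    rintro n ⟨S, -, rfl⟩
    exact Set.ncard_le_card S
  · exact ⟨C, hC, Set.ncard_coe_finset C⟩

lemma exists_chain (α : Type) [Fintype α] [PartialOrder α] :
    ∃ C : Finset α, IsChain (· ≤ ·) (C : Set α) ∧ C.card = heightP α := by
  classical
  have : heightP α ∈ {n | ∃ C : Set α, IsChain (· ≤ ·) C ∧ C.ncard = n} := by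
    apply Nat.sSup_mem
    · exact ⟨0, ∅, by simp, by simp⟩
    · refine ⟨Nat.card α, ?_⟩
      rintro n ⟨S, -, rfl⟩
      exact Set.ncard_le_card S
  obtain ⟨C, hC, h⟩ := this
  refine ⟨C.toFinset, by simpa using hC, ?_⟩
  rw [← h, Set.ncard_eq_toFinset_card']

lemma exists_rank (α : Type) [Fintype α] [PartialOrder α] :
    ∃ r : α → ℕ, (∀ x y, x < y → r x < r y) ∧ ∀ x, 1 ≤ r x ∧ r x ≤ heightP α := by
  classical
  let Fm : α → Finset (Finset α) := fun x =>
    Finset.univ.filter (fun C => IsChain (· ≤ ·) (C : Set α) ∧ ∀ c ∈ C, c ≤ x)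
  refine ⟨fun x => (Fm x).sup Finset.card, ?_, ?_⟩
  · intro x y hxy
    have hne : (Fm x).Nonempty := ⟨∅, by simp [Fm]⟩
    obtain ⟨C, hC, he⟩ := Finset.exists_mem_eq_sup (Fm x) hne Finset.card
    simp only [Fm, Finset.mem_filter, Finset.mem_univ, true_and] at hC
    have hy : y ∉ C := fun h => absurd (hC.2 y h) (not_le_of_gt hxy)
    have hmem : insert y C ∈ Fm y := by
      simp only [Fm, Finset.mem_filter, Finset.mem_univ, true_and, Finset.coe_insert]
      refine ⟨hC.1.insert ?_, ?_⟩
      · intro b hb _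
        exact Or.inr ((hC.2 b hb).trans hxy.le)
      · intro c hc
        rcases Finset.mem_insert.mp hc with rfl | hc
        · exact le_rfl
        · exact (hC.2 c hc).trans hxy.le
    have h2 := Finset.le_sup (f := Finset.card) hmem
    rw [Finset.card_insert_of_notMem hy] at h2
    show (Fm x).sup Finset.card < (Fm y).sup Finset.card
    omega
  · intro x
    constructor
    · have hmem : {x} ∈ Fm x := by simp [Fm]
      have h2 := Finset.le_sup (f := Finset.card) hmem
      simpa using h2
    · apply Finset.sup_le
      intro C hC
      simp only [Fm, Finset.mem_filter, Finset.mem_univ, true_and] at hC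
      exact chain_card_le C hC.1

/-- A longest chain, enumerated, with a compatible rank function. -/
lemma exists_enum (α : Type) [Fintype α] [PartialOrder α] [Nonempty α] :
    ∃ (r : α → ℕ) (C : Finset α) (c : ℕ → α), (∀ x y, x < y → r x < r y) ∧
      (∀ x, 1 ≤ r x ∧ r x ≤ heightP α) ∧ C.card = heightP α ∧
      (∀ i < heightP α, c i ∈ C ∧ r (c i) = i + 1) ∧
      (∀ i j, i < j → j < heightP α → c i < c j) ∧
      (∀ x ∈ C, ∃ i < heightP α, c i = x) := by
  classical
  obtain ⟨r, hr, hb⟩ := exists_rank α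
  obtain ⟨C, hC, hcard⟩ := exists_chain α
  have hinj : Set.InjOn r C := by
    intro x hx y hy hxy
    by_contra hne
    rcases hC hx hy hne with h | h
    · have := hr x y (lt_of_le_of_ne h hne); omega
    · have := hr y x (lt_of_le_of_ne h (Ne.symm hne)); omega
  have himg : C.image r = Finset.Icc 1 (heightP α) := by
    apply Finset.eq_of_subset_of_card_le
    · intro i hi
      obtain ⟨x, -, rfl⟩ := Finset.mem_image.mp hi
      exact Finset.mem_Icc.mpr (hb x)
    · rw [Finset.card_image_of_injOn hinj, hcard]; simp
  have hex : ∀ i : ℕ, ∃ x : α, i < heightP α → x ∈ C ∧ r x = i + 1 := by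
    intro i
    by_cases hi : i < heightP α
    · have : i + 1 ∈ C.image r := by rw [himg]; simp; omega
      obtain ⟨x, h1, h2⟩ := Finset.mem_image.mp this
      exact ⟨x, fun _ => ⟨h1, h2⟩⟩
    · exact ⟨Classical.arbitrary α, fun h => absurd h hi⟩
  choose c hc using hex
  refine ⟨r, C, c, hr, hb, hcard, hc, ?_, ?_⟩
  · intro i j hij hj
    have h1 := hc i (by omega)
    have h2 := hc j hj
    have hne : c i ≠ c j := by intro h; rw [h] at h1; omega
    rcases hC h1.1 h2.1 hne with h | h
    · exact lt_of_le_of_ne h hne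
    · have := hr _ _ (lt_of_le_of_ne h (Ne.symm hne)); omega
  · intro x hx
    have hbx := hb x
    have h1 := hc (r x - 1) (by omega)
    exact ⟨r x - 1, by omega, hinj h1.1 hx (by omega)⟩

lemma sum_enum {α : Type} [DecidableEq α] (h : ℕ) (c : ℕ → α) (C : Finset α) (r : α → ℕ)
    (hc : ∀ i < h, c i ∈ C ∧ r (c i) = i + 1) (hs : ∀ x ∈ C, ∃ i < h, c i = x) (F : α → ℤ) :
    ∑ i ∈ Finset.range h, F (c i) = ∑ x ∈ C, F x := by
  apply Finset.sum_bij (fun i _ => c i)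
  · intro i hi; exact (hc i (Finset.mem_range.mp hi)).1
  · intro i hi j hj hij
    have h1 := (hc i (Finset.mem_range.mp hi)).2
    have h2 := (hc j (Finset.mem_range.mp hj)).2
    rw [hij] at h1; omega
  · intro x hx
    obtain ⟨i, hi, h⟩ := hs x hx
    exact ⟨i, Finset.mem_range.mpr hi, h⟩
  · intro i hi; rfl

/-- Potential defined by a family of antichains. -/
noncomputable def Phi {α : Type} [PartialOrder α] {k : ℕ} (I : Finset (Fin k))
    (B : Fin k → Finset α) : Nd α → ℤ := by
  classical exact fun v => match v with
  | Nd.s => 0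
  | Nd.t => (I.card : ℤ)
  | Nd.lo x => ((I.filter (fun j => ∃ b ∈ B j, b < x)).card : ℤ)
  | Nd.hi x => ((I.filter (fun j => ∃ b ∈ B j, b ≤ x)).card : ℤ)

lemma Phi_diff {α : Type} [PartialOrder α] [DecidableEq α] {k : ℕ} (I : Finset (Fin k))
    (B : Fin k → Finset α) (hB : ∀ j ∈ I, IsAntichain (· ≤ ·) (B j : Set α))
    (hd : ∀ i ∈ I, ∀ j ∈ I, i ≠ j → Disjoint (B i) (B j)) (x : α) :
    Phi I B (Nd.hi x) - Phi I B (Nd.lo x) = if x ∈ I.biUnion B then 1 else 0 := by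
  classical
  simp only [Phi]
  have hsub : (I.filter (fun j => ∃ b ∈ B j, b ≤ x)) =
      (I.filter (fun j => ∃ b ∈ B j, b < x)) ∪ I.filter (fun j => x ∈ B j) := by
    ext j
    simp only [Finset.mem_filter, Finset.mem_union]
    constructor
    · rintro ⟨hj, b, hb, hbx⟩
      rcases hbx.lt_or_eq with h | h
      · exact Or.inl ⟨hj, b, hb, h⟩
      · exact Or.inr ⟨hj, h ▸ hb⟩
    · rintro (⟨hj, b, hb, hbx⟩ | ⟨hj, hx⟩)
      · exact ⟨hj, b, hb, hbx.le⟩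
      · exact ⟨hj, x, hx, le_rfl⟩
  have hdis : Disjoint (I.filter (fun j => ∃ b ∈ B j, b < x)) (I.filter (fun j => x ∈ B j)) := by
    rw [Finset.disjoint_left]
    intro j h1 h2
    simp only [Finset.mem_filter] at h1 h2
    obtain ⟨hj, b, hb, hbx⟩ := h1
    exact hB j hj hb h2.2 hbx.ne hbx.le
  have hcard : (I.filter (fun j => x ∈ B j)).card = if x ∈ I.biUnion B then 1 else 0 := by
    split_ifs with h
    · obtain ⟨j, hj, hx⟩ := Finset.mem_biUnion.mp h
      rw [Finset.card_eq_one]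
      refine ⟨j, ?_⟩
      ext i
      simp only [Finset.mem_filter, Finset.mem_singleton]
      constructor
      · rintro ⟨hi, hxi⟩
        by_contra hne
        exact Finset.disjoint_left.mp (hd i hi j hj hne) hxi hx
      · rintro rfl; exact ⟨hj, hx⟩
    · rw [Finset.card_eq_zero, Finset.filter_eq_empty_iff]
      intro j hj hx
      exact h (Finset.mem_biUnion.mpr ⟨j, hj, hx⟩)
  rw [hsub, Finset.card_union_of_disjoint hdis, hcard]
  push_cast
  ring

lemma Hc_le_Lc {α : Type} [PartialOrder α] (h : ℕ) (h1 : 1 ≤ h) (c : ℕ → α) (C : Finset α)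
    (hlt : ∀ i j, i < j → j < h → c i < c j) (i : ℕ) (hi : i ≤ h) :
    Arc h c C (Hc c i) 0 (Lc h c i) := by
  cases i with
  | zero =>
    have : 0 < h := h1
    simp only [Hc, Lc, this, if_true]
    exact Arc.sx _
  | succ i =>
    by_cases hh : i + 1 < h
    · simp only [Hc, Lc, hh, if_true]
      exact Arc.xy _ _ (hlt i (i+1) (by omega) hh)
    · simp only [Hc, Lc, hh, if_false]
      exact Arc.xt _

/-- The key combinatorial bound. -/
lemma lambda_bound {α : Type} [Fintype α] [PartialOrder α] [DecidableEq α] (h : ℕ) (h1 : 1 ≤ h)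
    (c : ℕ → α) (C : Finset α) (r : α → ℕ) (hcard : C.card = h)
    (hc : ∀ i < h, c i ∈ C ∧ r (c i) = i + 1) (hs : ∀ x ∈ C, ∃ i < h, c i = x)
    (hlt : ∀ i j, i < j → j < h → c i < c j)
    (g : Nd α → ℤ) (hgs : g Nd.s = 0) (n : ℕ) (p : ℕ → Nd α) (hp0 : p 0 = Nd.s)
    (hpn : p n = Nd.t)
    (hp : ∀ i < n, ∃ z, Arc h c C (p i) z (p (i+1)) ∧ g (p i) + z = g (p (i+1)))
    (hinj : ∀ i j, i < j → j ≤ n → p i ≠ p j)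
    {k : ℕ} (I : Finset (Fin k)) (B : Fin k → Finset α)
    (hB : ∀ j ∈ I, IsAntichain (· ≤ ·) (B j : Set α)) (hB3 : ∀ j ∈ I, (B j).card = 3)
    (hd : ∀ i ∈ I, ∀ j ∈ I, i ≠ j → Disjoint (B i) (B j)) :
    g Nd.t + I.card + h ≤ Fintype.card α := by
  classical
  set U := I.biUnion B with hU
  have hUcard : U.card = 3 * I.card := by
    rw [hU, Finset.card_biUnion hd, Finset.sum_congr rfl hB3]
    simp [mul_comm]
  have hdiff := Phi_diff I B hB hd
  set Φ := Phi I B with hΦ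
  have hΦs : Φ Nd.s = 0 := rfl
  have hΦt : Φ Nd.t = I.card := rfl
  have hxt : ∀ x, Φ (Nd.hi x) ≤ Φ Nd.t := by
    intro x
    simp only [hΦ, Phi]
    exact_mod_cast Finset.card_filter_le _ _
  have hsx : ∀ x, Φ Nd.s ≤ Φ (Nd.lo x) := by
    intro x
    simp only [hΦ, Phi]
    positivity
  have hxy : ∀ x y, x < y → Φ (Nd.hi x) ≤ Φ (Nd.lo y) := by
    intro x y hxy
    simp only [hΦ, Phi]
    norm_cast
    apply Finset.card_le_card
    intro j
    simp only [Finset.mem_filter]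
    rintro ⟨hj, b, hb, hbx⟩
    exact ⟨hj, b, hb, hbx.trans_lt hxy⟩
  have hgap : ∀ i ≤ h, Φ (Hc c i) ≤ Φ (Lc h c i) := by
    intro i hi
    cases i with
    | zero =>
      have : 0 < h := h1
      simp only [Hc, Lc, this, if_true]
      exact hsx _
    | succ i =>
      by_cases hh : i + 1 < h
      · simp only [Hc, Lc, hh, if_true]
        exact hxy _ _ (hlt i (i+1) (by omega) hh)
      · simp only [Hc, Lc, hh, if_false]
        exact hxt _
  let W : Finset α := Finset.univ \ (C ∪ U)
  let σ : Nd α → ℤ := fun v => (∑ x ∈ W, if v = Nd.lo x then (1:ℤ) else 0) +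
    ∑ i ∈ Finset.range (h+1), if v = Lc h c i then Φ (Lc h c i) - Φ (Hc c i) else 0
  have hσ1 : ∀ v, 0 ≤ ∑ x ∈ W, if v = Nd.lo x then (1:ℤ) else 0 := by
    intro v
    apply Finset.sum_nonneg
    intro x _
    split_ifs <;> norm_num
  have hterm : ∀ v, ∀ i ∈ Finset.range (h+1),
      (0:ℤ) ≤ if v = Lc h c i then Φ (Lc h c i) - Φ (Hc c i) else 0 := by
    intro v i hi
    have := hgap i (by have := Finset.mem_range.mp hi; omega)
    split_ifs <;> omega
  have hσ2 : ∀ v, 0 ≤ ∑ i ∈ Finset.range (h+1),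
      if v = Lc h c i then Φ (Lc h c i) - Φ (Hc c i) else 0 :=
    fun v => Finset.sum_nonneg (hterm v)
  have hσ0 : ∀ v, 0 ≤ σ v := fun v => add_nonneg (hσ1 v) (hσ2 v)
  have harc : ∀ v z w, Arc h c C v z w → z ≤ Φ w - Φ v + σ v := by
    intro v z w ha
    have h0 := hσ0 v
    cases ha with
    | sx x => have := hsx x; omega
    | xt x => have := hxt x; omega
    | xy x y hh => have := hxy x y hh; omega
    | up x hx =>
      have hdx := hdiff x
      by_cases hxU : x ∈ U
      · rw [if_pos hxU] at hdx; omega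
      · rw [if_neg hxU] at hdx
        have hxW : x ∈ W := by simp [W, hx, hxU]
        have h2 : (1:ℤ) ≤ ∑ y ∈ W, if Nd.lo x = Nd.lo y then (1:ℤ) else 0 := by
          have := Finset.single_le_sum (f := fun y => if Nd.lo x = Nd.lo y then (1:ℤ) else 0)
            (s := W) (fun y _ => by split_ifs <;> norm_num) hxW
          simpa using this
        have h3 := hσ2 (Nd.lo x)
        have h4 : (1:ℤ) ≤ σ (Nd.lo x) := by
          simp only [σ]; linarith
        omega
    | free x =>
      have hdx := hdiff x
      split_ifs at hdx <;> omega
    | down x hx =>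
      have hdx := hdiff x
      split_ifs at hdx <;> omega
    | back i hi =>
      have h2 := Finset.single_le_sum (hterm (Lc h c i))
        (Finset.mem_range.mpr (Nat.lt_succ_of_le hi))
      rw [if_pos rfl] at h2
      have h3 := hσ1 (Lc h c i)
      have h4 : Φ (Lc h c i) - Φ (Hc c i) ≤ σ (Lc h c i) := by
        simp only [σ]; linarith
      omega
  -- sum along the path
  have hpath : ∀ m ≤ n, g (p m) ≤ Φ (p m) + ∑ i ∈ Finset.range m, σ (p i) := by
    intro m
    induction m with
    | zero => intro _; simp [hp0, hgs, hΦs]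
    | succ m ih =>
      intro hm
      have h2 := ih (by omega)
      obtain ⟨z, hz, hz2⟩ := hp m (by omega)
      have h3 := harc _ _ _ hz
      rw [Finset.sum_range_succ]
      linarith
  have hfin := hpath n le_rfl
  rw [hpn] at hfin
  have hpinj : Set.InjOn p (Finset.range n : Set ℕ) := by
    intro i hi j hj hij
    have hi' := Finset.mem_range.mp hi
    have hj' := Finset.mem_range.mp hj
    rcases lt_trichotomy i j with hh | hh | hh
    · exact absurd hij (hinj i j hh hj'.le)
    · exact hh
    · exact absurd hij.symm (hinj j i hh hi'.le)
  have hsum1 : ∑ i ∈ Finset.range n, σ (p i) = ∑ v ∈ (Finset.range n).image p, σ v :=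
    (Finset.sum_image hpinj).symm
  have hsum2 : ∀ X : Finset (Nd α), ∑ v ∈ X, σ v ≤
      W.card + ∑ i ∈ Finset.range (h+1), (Φ (Lc h c i) - Φ (Hc c i)) := by
    intro X
    simp only [σ]
    rw [Finset.sum_add_distrib]
    apply add_le_add
    · rw [Finset.sum_comm, Finset.card_eq_sum_ones]
      push_cast
      apply Finset.sum_le_sum
      intro x _
      rw [Finset.sum_ite_eq']
      split_ifs <;> norm_num
    · rw [Finset.sum_comm]
      apply Finset.sum_le_sum
      intro i hi
      have := hgap i (by have := Finset.mem_range.mp hi; omega)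
      rw [Finset.sum_ite_eq']
      split_ifs <;> omega
  have hsum3 := hsum2 ((Finset.range n).image p)
  rw [telescope, sum_enum h c C r hc hs (fun x => Φ (Nd.hi x) - Φ (Nd.lo x)),
    Finset.sum_congr rfl (fun x _ => hdiff x)] at hsum3
  have hCU : ∑ x ∈ C, (if x ∈ U then (1:ℤ) else 0) = ((C ∩ U).card : ℤ) := by
    rw [← Finset.filter_mem_eq_inter, Finset.card_filter]
    push_cast
    rfl
  rw [hCU, ← hsum1] at hsum3
  have hW : W.card + (C ∪ U).card = Fintype.card α := by
    have := Finset.card_sdiff_add_card_eq_card (Finset.subset_univ (C ∪ U))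
    simpa [W] using this
  have hIE := Finset.card_union_add_card_inter C U
  omega

/-- Existence of a coloring by `h` antichains with many color classes of size three. -/
lemma exists_coloring {α : Type} [Fintype α] [PartialOrder α] [DecidableEq α] [Nonempty α]
    (hw : widthP α ≤ 3) :
    ∃ (ι : Type) (_ : Fintype ι) (_ : DecidableEq ι) (col : α → ι),
      Fintype.card ι = heightP α ∧ (∀ x y, col x = col y → ¬ x < y) ∧
      ∀ (k : ℕ) (I : Finset (Fin k)) (B : Fin k → Finset α),
        (∀ j ∈ I, IsAntichain (· ≤ ·) (B j : Set α)) → (∀ j ∈ I, (B j).card = 3) →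
        (∀ i ∈ I, ∀ j ∈ I, i ≠ j → Disjoint (B i) (B j)) →
        I.card ≤ (Finset.univ.filter
          (fun i : ι => (Finset.univ.filter (fun x => col x = i)).card = 3)).card := by
  classical
  obtain ⟨r, C, c, hr, hb, hcard, hc, hlt, hs⟩ := exists_enum α
  set h := heightP α with hh
  have h1 : 1 ≤ h := by
    have := hb (Classical.arbitrary α); omega
  let f0 : Nd α → ℤ := fun v => match v with
    | Nd.s => 0
    | Nd.t => h
    | Nd.lo x => (r x : ℤ) - 1
    | Nd.hi x => r x
  have hf0 : ∀ v z w, Arc h c C v z w → f0 v + z ≤ f0 w := by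
    intro v z w ha
    cases ha with
    | sx x => have := hb x; simp only [f0]; omega
    | xt x => have := hb x; simp only [f0]; omega
    | xy x y hh => have := hr x y hh; simp only [f0]; omega
    | up x hx => simp only [f0]; omega
    | free x => simp only [f0]; omega
    | down x hx => simp only [f0]; omega
    | back i hi =>
      have e1 : f0 (Lc h c i) = i := by
        by_cases hi' : i < h
        · have := (hc i hi').2
          simp only [Lc, hi', if_true, f0]; omega
        · simp only [Lc, hi', if_false, f0]; omega
      have e2 : f0 (Hc c i) = i := by
        cases i with
        | zero => simp [Hc, f0]
        | succ i =>
          have := (hc i (by omega)).2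
          simp only [Hc, f0]; omega
      omega
  have lb : ∀ f : Nd α → ℤ, (∀ v z w, Arc h c C v z w → f v + z ≤ f w) → f Nd.s = 0 →
      0 ≤ f Nd.t := by
    intro f hf hfs
    have x : α := Classical.arbitrary α
    have e1 := hf _ _ _ (Arc.sx x)
    have e2 := hf _ _ _ (Arc.free x)
    have e3 := hf _ _ _ (Arc.xt x)
    omega
  obtain ⟨g, hg, hgs, n, p, hp0, hpn, hp, hinj⟩ :=
    exists_potential (Arc h c C) Nd.s Nd.t f0 hf0 rfl lb
  have hbound := fun (k : ℕ) (I : Finset (Fin k)) (B : Fin k → Finset α) =>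
    lambda_bound h h1 c C r hcard hc hs hlt g hgs n p hp0 hpn hp hinj I B
  have hlam := lb g hg hgs
  obtain ⟨lam, hlam'⟩ := Int.eq_ofNat_of_zero_le hlam
  have hm0 : ∀ x, 0 ≤ g (Nd.lo x) := by
    intro x; have := hg _ _ _ (Arc.sx x); omega
  have hul : ∀ x, g (Nd.hi x) ≤ lam := by
    intro x; have := hg _ _ _ (Arc.xt x); omega
  have huC : ∀ x ∈ C, g (Nd.hi x) ≤ g (Nd.lo x) + 1 := by
    intro x hx; have := hg _ _ _ (Arc.down x hx); omega
  have hmu : ∀ x, g (Nd.lo x) ≤ g (Nd.hi x) := by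
    intro x; have := hg _ _ _ (Arc.free x); omega
  have hnC : ∀ x, x ∉ C → g (Nd.lo x) + 1 ≤ g (Nd.hi x) := by
    intro x hx; exact hg _ _ _ (Arc.up x hx)
  have hord : ∀ x y, x < y → g (Nd.hi x) ≤ g (Nd.lo y) := by
    intro x y hxy; have := hg _ _ _ (Arc.xy x y hxy); omega
  have htel := telescope h c g
  rw [Finset.sum_eq_zero, sum_enum h c C r hc hs (fun x => g (Nd.hi x) - g (Nd.lo x))] at htel
  swap
  · intro i hi
    have hi' : i ≤ h := by have := Finset.mem_range.mp hi; omega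
    have e1 := hg _ _ _ (Hc_le_Lc h h1 c C hlt i hi')
    have e2 := hg _ _ _ (Arc.back (C := C) i hi')
    omega
  let T : Finset α := Finset.univ.filter (fun x => g (Nd.lo x) + 1 ≤ g (Nd.hi x))
  have hT : ∀ x, x ∈ T ↔ g (Nd.lo x) + 1 ≤ g (Nd.hi x) := by intro x; simp [T]
  have hCT : ((C ∩ T).card : ℤ) = lam := by
    have e : ∑ x ∈ C, (g (Nd.hi x) - g (Nd.lo x)) = ∑ x ∈ C, (if x ∈ T then (1:ℤ) else 0) := by
      apply Finset.sum_congr rfl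
      intro x hx
      have e1 := huC x hx
      have e2 := hmu x
      have e3 := hT x
      split_ifs with hxT
      · have := e3.mp hxT; omega
      · have : ¬ _ := fun h => hxT (e3.mpr h)
        omega
    have e' : ∑ x ∈ C, (if x ∈ T then (1:ℤ) else 0) = ((C ∩ T).card : ℤ) := by
      rw [← Finset.filter_mem_eq_inter, Finset.card_filter]
      push_cast
      rfl
    rw [e, e'] at htel
    omega
  have hTc : (Finset.univ \ T) = C \ (C ∩ T) := by
    ext x
    simp only [Finset.mem_sdiff, Finset.mem_univ, true_and, Finset.mem_inter]
    constructor
    · intro hx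
      refine ⟨?_, fun h => hx h.2⟩
      by_contra hxC
      exact hx ((hT x).mpr (hnC x hxC))
    · rintro ⟨h1, h2⟩ h3
      exact h2 ⟨h1, h3⟩
  have hTc1 : (Finset.univ \ T).card + lam = h := by
    have e := Finset.card_sdiff_add_card_eq_card (Finset.inter_subset_left : C ∩ T ⊆ C)
    rw [hTc]
    omega
  have hTc2 : (Finset.univ \ T).card + T.card = Fintype.card α := by
    have := Finset.card_sdiff_add_card_eq_card (Finset.subset_univ T)
    simpa using this
  have hlev : ∀ x, x ∈ T → (g (Nd.lo x)).toNat < lam := by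
    intro x hx
    have e1 := (hT x).mp hx
    have e2 := hul x
    have e3 := hm0 x
    omega
  let col : α → Fin lam ⊕ {x // x ∈ Finset.univ \ T} := fun x =>
    if hx : x ∈ T then Sum.inl ⟨(g (Nd.lo x)).toNat, hlev x hx⟩ else Sum.inr ⟨x, by simp [hx]⟩
  have hanti : ∀ x y, col x = col y → ¬ x < y := by
    intro x y hxy hlt'
    by_cases hx : x ∈ T <;> by_cases hy : y ∈ T <;>
      simp only [col, hx, hy, dif_pos, dif_neg, not_false_eq_true, reduceCtorEq, Sum.inl.injEq,
        Sum.inr.injEq, Fin.mk.injEq, Subtype.mk.injEq] at hxy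
    · have e1 := (hT x).mp hx
      have e2 := hord x y hlt'
      have e3 := hm0 x
      omega
    · exact hlt'.ne hxy
  refine ⟨Fin lam ⊕ {x // x ∈ Finset.univ \ T}, inferInstance, inferInstance, col, ?_, hanti, ?_⟩
  · refine (@Nat.card_eq_fintype_card _ (_)).symm.trans ?_
    rw [Nat.card_sum, Nat.card_fin, Nat.card_eq_fintype_card,
      Fintype.card_coe]
    omega
  · intro k I B hB hB3 hd
    have hbd := hbound k I B hB hB3 hd
    let fib : Fin lam → Finset α := fun i => Finset.univ.filter (fun x => col x = Sum.inl i)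
    have hTsum : T.card = ∑ i : Fin lam, (fib i).card := by
      rw [← Finset.card_biUnion]
      · congr 1
        ext x
        simp only [Finset.mem_biUnion, Finset.mem_univ, true_and, fib, Finset.mem_filter]
        constructor
        · intro hx
          exact ⟨⟨(g (Nd.lo x)).toNat, hlev x hx⟩, by simp only [col, hx, dif_pos]⟩
        · rintro ⟨i, hi⟩
          by_contra hx
          simp [col, hx] at hi
      · intro i _ j _ hij
        rw [Function.onFun, Finset.disjoint_left]
        intro x hx hy
        simp only [fib, Finset.mem_filter, Finset.mem_univ, true_and] at hx hy
        rw [hx] at hy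
        exact hij (Sum.inl.inj hy)
    have hfib3 : ∀ i, (fib i).card ≤ 2 + if (fib i).card = 3 then 1 else 0 := by
      intro i
      have : (fib i).card ≤ 3 := by
        refine (antichain_card_le _ ?_).trans hw
        intro x hx y hy hne hle
        simp only [fib, Finset.coe_filter, Finset.mem_univ, true_and, Set.mem_ofPred_eq] at hx hy
        exact hanti x y (hx.trans hy.symm) (lt_of_le_of_ne hle hne)
      split_ifs <;> omega
    have hT3 : T.card ≤ 2 * lam + (Finset.univ.filter (fun i => (fib i).card = 3)).card := by
      rw [hTsum]
      refine (Finset.sum_le_sum (fun i _ => hfib3 i)).trans ?_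
      rw [Finset.sum_add_distrib, Finset.card_filter]
      simp [mul_comm]
    refine le_trans (b := (Finset.univ.filter (fun i => (fib i).card = 3)).card) ?_
      (Finset.card_le_card_of_injOn Sum.inl ?_ ?_)
    · omega
    · intro i hi
      simp only [Finset.coe_filter, Finset.mem_univ, true_and, Set.mem_ofPred_eq] at hi ⊢
      rw [← hi]
    · intro i _ j _ hij
      exact Sum.inl.inj hij

/-- Sorted sequences of values in `{1,2,3}`. -/
lemma sorted_sum {h : ℕ} (s : Fin h → ℕ) (hs : Antitone s) (h3 : ∀ i, s i ≤ 3)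
    (k : ℕ) (hk : k ≤ h) (d : ℕ) (d1 : d ≤ 3 * k)
    (d2 : d ≤ 2 * k + (Finset.univ.filter (fun i => s i = 3)).card)
    (d3 : d + h ≤ (∑ i, s i) + k) :
    d ≤ ∑ i ∈ Finset.univ.filter (fun i : Fin h => (i : ℕ) < k), s i := by
  classical
  set K := Finset.univ.filter (fun i : Fin h => (i : ℕ) < k) with hK
  have hKc : K.card = k := by
    rw [hK, Fin.card_filter_val_lt]; omega
  have hmem : ∀ i : Fin h, i ∈ K ↔ (i : ℕ) < k := by intro i; simp [hK]
  by_cases c1 : ∀ i ∈ K, s i = 3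
  · rw [Finset.sum_congr rfl c1]; simp [hKc]; omega
  push Not at c1
  obtain ⟨i0, hi0, hi0'⟩ := c1
  by_cases c2 : ∀ i ∈ K, 2 ≤ s i
  · have hsub : (Finset.univ.filter (fun i => s i = 3)) ⊆ K.filter (fun i => s i = 3) := by
      intro j hj
      simp only [Finset.mem_filter, Finset.mem_univ, true_and] at hj ⊢
      refine ⟨?_, hj⟩
      by_contra hjK
      have e1 := (hmem i0).mp hi0
      have e2 : ¬ (j : ℕ) < k := fun h => hjK ((hmem j).mpr h)
      have : s j ≤ s i0 := hs (by rw [Fin.le_def]; omega)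
      have := h3 i0
      omega
    have hc := Finset.card_le_card hsub
    have : ∑ i ∈ K, (2 + if s i = 3 then 1 else 0) ≤ ∑ i ∈ K, s i := by
      apply Finset.sum_le_sum
      intro i hi
      have := c2 i hi
      split_ifs <;> omega
    rw [Finset.sum_add_distrib, ← Finset.card_filter] at this
    simp only [Finset.sum_const, hKc, smul_eq_mul] at this
    omega
  · push Not at c2
    obtain ⟨i1, hi1, hi1'⟩ := c2
    have hsplit := Finset.sum_add_sum_compl K s
    have hle : ∑ i ∈ Kᶜ, s i ≤ ∑ i ∈ Kᶜ, 1 := by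
      apply Finset.sum_le_sum
      intro j hj
      have e1 := (hmem i1).mp hi1
      have e2 : ¬ (j : ℕ) < k := fun h => (Finset.mem_compl.mp hj) ((hmem j).mpr h)
      have : s j ≤ s i1 := hs (by rw [Fin.le_def]; omega)
      omega
    have hcc := Finset.card_compl K
    rw [Fintype.card_fin] at hcc
    simp only [Finset.sum_const, smul_eq_mul, mul_one] at hle
    omega

lemma main_nonempty (α : Type) [Fintype α] [PartialOrder α] [DecidableEq α] [Nonempty α]
    (hw : widthP α ≤ 3) : DDecomposable α := by
  classical
  obtain ⟨ι, _, _, col, hcard, hanti, hmax⟩ := exists_coloring hw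
  obtain ⟨C, hC, hCc⟩ := exists_chain α
  let sz : ι → ℕ := fun i => (Finset.univ.filter (fun x => col x = i)).card
  let e0 : Fin (heightP α) ≃ ι := (Fintype.equivFinOfCardEq hcard).symm
  let e : Fin (heightP α) ≃ ι := (Tuple.sort (fun i => 3 - sz (e0 i))).trans e0
  have hsz3 : ∀ i, sz i ≤ 3 := by
    intro i
    refine (antichain_card_le _ ?_).trans hw
    intro x hx y hy hne hle
    simp only [Finset.coe_filter, Finset.mem_univ, true_and, Set.mem_ofPred_eq] at hx hy
    exact hanti x y (hx.trans hy.symm) (lt_of_le_of_ne hle hne)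
  have hanti' : Antitone (fun i => sz (e i)) := by
    intro i j hij
    have h1 := Tuple.monotone_sort (fun i => 3 - sz (e0 i)) hij
    have h2 := hsz3 (e i)
    have h3 := hsz3 (e j)
    simp only [Function.comp] at h1
    change 3 - sz (e i) ≤ 3 - sz (e j) at h1
    show sz (e j) ≤ sz (e i)
    omega
  have hfa : ∀ i, IsAntichain (· ≤ ·) {x | col x = e i} := by
    intro i x hx y hy hne hle
    exact hanti x y (Eq.trans hx (Eq.symm hy)) (lt_of_le_of_ne hle hne)
  have hN : ∑ i, sz (e i) = Fintype.card α := by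
    rw [Equiv.sum_comp e sz, ← Finset.card_univ (α := α)]
    exact (Finset.card_eq_sum_card_fiberwise (fun x _ => Finset.mem_univ (col x))).symm
  refine ⟨fun i => {x | col x = e i}, hfa, ?_, ?_, ?_⟩
  · intro i j hij
    rw [Set.disjoint_left]
    intro x hx hy
    exact hij (e.injective (Eq.trans (Eq.symm hx) hy))
  · ext x
    simp only [Set.mem_iUnion, Set.mem_ofPred_eq, Set.mem_univ, iff_true]
    exact ⟨e.symm (col x), by simp⟩
  · intro k hk
    have hbdd : BddAbove {n | ∃ A : Fin k → Set α,
        (∀ i, IsAntichain (· ≤ ·) (A i)) ∧ (⋃ i, A i).ncard = n} := by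
      refine ⟨Nat.card α, ?_⟩
      rintro n ⟨S, -, rfl⟩
      exact Set.ncard_le_card _
    apply le_antisymm
    · apply le_csSup hbdd
      refine ⟨fun i => {x | col x = e (Fin.castLE hk i)}, fun i => hfa _, ?_⟩
      congr 1
      ext x
      simp only [Set.mem_iUnion, Set.mem_ofPred_eq]
      constructor
      · rintro ⟨i, hi⟩
        exact ⟨Fin.castLE hk i, i.2, hi⟩
      · rintro ⟨i, hi, hx⟩
        exact ⟨⟨i, hi⟩, hx⟩
    · apply csSup_le
      · exact ⟨_, fun _ => ∅, by simp, rfl⟩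
      rintro d ⟨A, hA, rfl⟩
      have hleft : (⋃ i : Fin (heightP α), ⋃ (_ : (i : ℕ) < k), {x | col x = e i}).ncard =
          ∑ i ∈ Finset.univ.filter (fun i : Fin (heightP α) => (i : ℕ) < k), sz (e i) := by
        have : (⋃ i : Fin (heightP α), ⋃ (_ : (i : ℕ) < k), {x | col x = e i}) =
            (((Finset.univ.filter (fun i : Fin (heightP α) => (i : ℕ) < k)).biUnion
              (fun i => Finset.univ.filter (fun x => col x = e i)) : Finset α) : Set α) := by
          ext x; simp
        rw [this, Set.ncard_coe_finset, Finset.card_biUnion]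
        intro i _ j _ hij
        rw [Function.onFun, Finset.disjoint_left]
        intro x hx hy
        simp only [Finset.mem_filter, Finset.mem_univ, true_and] at hx hy
        exact hij (e.injective (hx.symm.trans hy))
      -- disjointify
      let B : Fin k → Finset α := fun i =>
        Finset.univ.filter (fun x => x ∈ A i ∧ ∀ j < i, x ∉ A j)
      have hBa : ∀ i, IsAntichain (· ≤ ·) (B i : Set α) := by
        intro i
        apply (hA i).subset
        intro x hx
        simp only [B, Finset.coe_filter, Finset.mem_univ, true_and, Set.mem_ofPred_eq] at hx
        exact hx.1
      have hBd : ∀ i j, i ≠ j → Disjoint (B i) (B j) := by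
        intro i j hij
        rw [Finset.disjoint_left]
        intro x hx hy
        simp only [B, Finset.mem_filter, Finset.mem_univ, true_and] at hx hy
        rcases lt_or_gt_of_ne hij with h | h
        · exact hy.2 i h hx.1
        · exact hx.2 j h hy.1
      have hBU : (⋃ i, A i) = ((Finset.univ.biUnion B : Finset α) : Set α) := by
        ext x
        simp only [Set.mem_iUnion, Finset.coe_biUnion, Finset.coe_univ, Set.mem_univ,
          Set.iUnion_true, B, Finset.coe_filter, Finset.mem_univ, true_and, Set.mem_ofPred_eq]
        constructor
        · rintro ⟨i, hi⟩
          obtain ⟨m, hm, hmin⟩ := WellFounded.has_min (wellFounded_lt (α := Fin k))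
            {i | x ∈ A i} ⟨i, hi⟩
          exact ⟨m, hm, fun j hj hx => hmin j hx hj⟩
        · rintro ⟨i, hi, -⟩
          exact ⟨i, hi⟩
      have hBc : (⋃ i, A i).ncard = ∑ i, (B i).card := by
        rw [hBU, Set.ncard_coe_finset, Finset.card_biUnion]
        intro i _ j _ hij
        exact hBd i j hij
      have hB3 : ∀ i, (B i).card ≤ 3 := fun i => (antichain_card_le _ (hBa i)).trans hw
      rw [hleft]
      apply sorted_sum (fun i => sz (e i)) hanti' (fun i => hsz3 _) k hk
      · rw [hBc]
        refine (Finset.sum_le_sum (fun i _ => hB3 i)).trans ?_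
        simp [mul_comm]
      · have h1 := hmax k (Finset.univ.filter (fun i => (B i).card = 3)) B (fun j _ => hBa j)
          (fun j hj => (Finset.mem_filter.mp hj).2) (fun i _ j _ hij => hBd i j hij)
        have h2 : (Finset.univ.filter (fun i => sz i = 3)).card =
            (Finset.univ.filter (fun i => sz (e i) = 3)).card := by
          rw [Finset.card_filter, Finset.card_filter]
          exact (Equiv.sum_comp e (fun i => if sz i = 3 then 1 else 0)).symm
        have h3 : ∑ i, (B i).card ≤ ∑ i, (2 + if (B i).card = 3 then 1 else 0) := by
          apply Finset.sum_le_sum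
          intro i _
          have := hB3 i
          split_ifs <;> omega
        rw [Finset.sum_add_distrib, ← Finset.card_filter] at h3
        simp only [Finset.sum_const, Finset.card_univ, Fintype.card_fin, smul_eq_mul] at h3
        rw [hBc]
        change _ ≤ (Finset.univ.filter (fun i => sz i = 3)).card at h1
        omega
      · rw [hN, hBU, Set.ncard_coe_finset]
        have hCA : (C ∩ Finset.univ.biUnion B).card ≤ k := by
          rw [Finset.inter_biUnion]
          refine Finset.card_biUnion_le.trans ?_
          have : ∀ i ∈ (Finset.univ : Finset (Fin k)), (C ∩ B i).card ≤ 1 := by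
            intro i _
            rw [Finset.card_le_one]
            intro x hx y hy
            rw [Finset.mem_inter] at hx hy
            by_contra hne
            rcases hC hx.1 hy.1 hne with h | h
            · exact hBa i hx.2 hy.2 hne h
            · exact hBa i hy.2 hx.2 (Ne.symm hne) h
          refine (Finset.sum_le_sum this).trans ?_
          simp
        have h1 := Finset.card_union_add_card_inter C (Finset.univ.biUnion B)
        have h2 := Finset.card_le_univ (C ∪ Finset.univ.biUnion B)
        omega

end DDec

/-- Every finite poset of width at most `3` is d-decomposable. -/
theorem dDecomposable_of_width_le_three
    (α : Type) [Fintype α] [PartialOrder α] (h : widthP α ≤ 3) :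
    DDecomposable α := by
  classical
  rcases isEmpty_or_nonempty α with hα | hα
  · have hz : ∀ S : Set α, S.ncard = 0 := by
      intro S
      rw [Set.eq_empty_of_isEmpty S, Set.ncard_empty]
    refine ⟨fun _ => ∅, by simp, by simp, ?_, ?_⟩
    · ext x; exact (hα.false x).elim
    · intro k _
      rw [hz]
      unfold dk
      symm
      apply Nat.le_zero.mp
      apply csSup_le
      · exact ⟨_, fun _ => ∅, by simp, rfl⟩
      · rintro d ⟨A, -, rfl⟩
        rw [hz]
  · exact DDec.main_nonempty α h
end

section
/- Every finite series-parallel poset is both d-decomposable and c-decomposable. In particular, every finite weak order is both d-decomposable and c-decomposable. -/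
/-- Series-parallel posets: the smallest class of posets containing the
one-element poset and closed under parallel composition (disjoint sum),
series composition (lexicographic sum), and order isomorphism. -/
inductive IsSeriesParallel : ∀ (α : Type) [PartialOrder α], Prop where
  | single (α : Type) [PartialOrder α] (h : ∃ a : α, ∀ b : α, b = a) :
      IsSeriesParallel α
  | parallel (α β : Type) [PartialOrder α] [PartialOrder β] :
      IsSeriesParallel α → IsSeriesParallel β → IsSeriesParallel (α ⊕ β)
  | series (α β : Type) [PartialOrder α] [PartialOrder β] :
      IsSeriesParallel α → IsSeriesParallel β → IsSeriesParallel (α ⊕ₗ β)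
  | iso (α β : Type) [PartialOrder α] [PartialOrder β] :
      IsSeriesParallel α → Nonempty (β ≃o α) → IsSeriesParallel β

/-- A weak order: there is a level function `f` with `a < b` iff
`f a < f b`. -/
def IsWeakOrder (α : Type*) [PartialOrder α] : Prop :=
  ∃ f : α → ℕ, ∀ a b : α, a < b ↔ f a < f b


section Helpers
open Finset
open scoped Classical

/-- Good colouring of a finite conflict relation. -/
def GoodCol (α : Type) [Fintype α] (r : α → α → Prop) : Prop :=
  ∃ (n : ℕ) (f : α → ℕ),
    (∀ x, f x < n) ∧
    (∀ x y, x ≠ y → f x = f y → ¬ r x y) ∧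
    (∃ C : Finset α, C.card = n ∧ ∀ x ∈ C, ∀ y ∈ C, x ≠ y → r x y) ∧
    (∀ i j, i ≤ j → (univ.filter (fun x => f x = j)).card ≤ (univ.filter (fun x => f x = i)).card) ∧
    (∀ (S : Finset α) (g : α → ℕ), (∀ x ∈ S, ∀ y ∈ S, x ≠ y → g x = g y → ¬ r x y) →
      S.card ≤ (univ.filter (fun x => f x < (S.image g).card)).card)

theorem card_filter_sum {α β : Type} [Fintype α] [Fintype β] (p : α ⊕ β → Prop)
    {_ : DecidablePred p} :
    (univ.filter p).card = (univ.filter (fun a => p (Sum.inl a))).card +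
      (univ.filter (fun b => p (Sum.inr b))).card := by
  simp only [Finset.card_filter, Fintype.sum_sum_type]

theorem card_sum_split {α β : Type} [Fintype α] [Fintype β] (S : Finset (α ⊕ β)) :
    S.card = (univ.filter (fun a => Sum.inl a ∈ S)).card +
      (univ.filter (fun b => Sum.inr b ∈ S)).card := by
  refine Eq.trans ?_ (card_filter_sum (fun x => x ∈ S))
  congr 1
  ext x; simp

theorem card_lt_mono {α : Type} [Fintype α] (f : α → ℕ) {i j : ℕ} (h : i ≤ j) :
    (univ.filter (fun x => f x < i)).card ≤ (univ.filter (fun x => f x < j)).card := by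
  apply Finset.card_le_card
  intro x
  simp only [mem_filter, mem_univ, true_and]
  omega

theorem sum_le_sum_range (b : ℕ → ℕ) (hb : ∀ i j, i ≤ j → b j ≤ b i) (T : Finset ℕ) :
    ∑ t ∈ T, b t ≤ ∑ t ∈ range T.card, b t := by
  induction T using Finset.induction_on_max with
  | empty => simp
  | insert a s hs ih =>
    have ha : a ∉ s := fun h => lt_irrefl _ (hs a h)
    rw [Finset.sum_insert ha, Finset.card_insert_of_notMem ha, Finset.sum_range_succ]
    have : s.card ≤ a := by
      have h2 : s ⊆ range a := fun x hx => Finset.mem_range.2 (hs x hx)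
      simpa using Finset.card_le_card h2
    have := hb _ _ this
    omega

theorem card_mem_eq_sum {α : Type} [Fintype α] (f : α → ℕ) (T : Finset ℕ) :
    (univ.filter (fun x => f x ∈ T)).card =
      ∑ t ∈ T, (univ.filter (fun x => f x = t)).card := by
  rw [Finset.card_eq_sum_card_fiberwise (f := f) (t := T)]
  · apply Finset.sum_congr rfl
    intro t ht
    congr 1
    ext x
    simp only [mem_filter, mem_univ, true_and]
    constructor
    · exact fun h => h.2
    · intro h; exact ⟨h ▸ ht, h⟩
  · intro x hx
    simpa using hx

theorem GoodCol.of_unordered {α : Type} [Fintype α] {r : α → α → Prop} (n : ℕ) (F : α → ℕ)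
    (hn : ∀ x, F x < n)
    (hp : ∀ x y, x ≠ y → F x = F y → ¬ r x y)
    (hC : ∃ C : Finset α, C.card = n ∧ ∀ x ∈ C, ∀ y ∈ C, x ≠ y → r x y)
    (hS : ∀ (S : Finset α) (g : α → ℕ), (∀ x ∈ S, ∀ y ∈ S, x ≠ y → g x = g y → ¬ r x y) →
      ∃ T : Finset ℕ, T.card ≤ (S.image g).card ∧
        S.card ≤ (univ.filter (fun x => F x ∈ T)).card) : GoodCol α r := by
  let a : Fin n → ℕᵒᵈ := fun i => OrderDual.toDual (univ.filter (fun x => F x = i)).card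
  let σ := Tuple.sort a
  have hσ : Monotone (a ∘ σ) := Tuple.monotone_sort a
  let f : α → ℕ := fun x => (σ.symm ⟨F x, hn x⟩ : Fin n)
  have hf : ∀ x y, f x = f y ↔ F x = F y := by
    intro x y
    simp only [f, Fin.val_inj, EmbeddingLike.apply_eq_iff_eq, Fin.mk.injEq]
  have hfn : ∀ x, f x < n := fun x => (σ.symm ⟨F x, hn x⟩ : Fin n).2
  have hcls : ∀ i : Fin n, (univ.filter (fun x => f x = i)).card
      = (univ.filter (fun x => F x = σ i)).card := by
    intro i
    congr 1
    ext x
    simp only [mem_filter, mem_univ, true_and, f, Fin.val_inj, Equiv.symm_apply_eq]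
    rw [Fin.ext_iff]
  have hanti : ∀ i j, i ≤ j → (univ.filter (fun x => f x = j)).card ≤
      (univ.filter (fun x => f x = i)).card := by
    intro i j hij
    by_cases hj : j < n
    · have h1 := hσ (show (⟨i, by omega⟩ : Fin n) ≤ ⟨j, hj⟩ from hij)
      have h2 := hcls ⟨i, by omega⟩
      have h3 := hcls ⟨j, hj⟩
      simp only at h2 h3
      rw [h2, h3]
      exact h1
    · have : (univ.filter (fun x => f x = j)) = ∅ := by
        apply Finset.filter_eq_empty_iff.2
        intro x _ h
        have := hfn x
        omega
      rw [this]; simp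
  refine ⟨n, f, hfn, fun x y hxy h => hp x y hxy ((hf x y).1 h), hC, hanti, ?_⟩
  intro S g hg
  obtain ⟨T, hT1, hT2⟩ := hS S g hg
  let T' : Finset ℕ := (univ.filter (fun x => F x ∈ T)).image f
  have hT' : T'.card ≤ T.card := by
    have : T'.card = ((univ.filter (fun x => F x ∈ T)).image F).card := by
      let e : ℕ → ℕ := fun m => if h : m < n then (σ.symm ⟨m, h⟩ : Fin n) else m
      have h1 : T' = ((univ.filter (fun x => F x ∈ T)).image F).image e := by
        rw [Finset.image_image]
        apply Finset.image_congr
        intro x _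
        simp [e, f, hn x]
      rw [h1, Finset.card_image_of_injOn]
      intro u hu v hv huv
      simp only [coe_image, Set.mem_image, mem_coe] at hu hv
      obtain ⟨x, _, rfl⟩ := hu
      obtain ⟨y, _, rfl⟩ := hv
      simp only [e, hn x, hn y, dif_pos] at huv
      exact (hf x y).1 huv
    rw [this]
    apply Finset.card_le_card
    intro t ht
    simp only [mem_image, mem_filter, mem_univ, true_and] at ht
    obtain ⟨x, hx, rfl⟩ := ht
    exact hx
  calc S.card ≤ _ := hT2
    _ ≤ (univ.filter (fun x => f x ∈ T')).card := by
        apply Finset.card_le_card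
        intro x hx
        simp only [mem_filter, mem_univ, true_and] at hx ⊢
        exact Finset.mem_image_of_mem f (by simpa using hx)
    _ = _ := card_mem_eq_sum f T'
    _ ≤ _ := sum_le_sum_range _ hanti T'
    _ = (univ.filter (fun x => f x ∈ range T'.card)).card := (card_mem_eq_sum f _).symm
    _ = (univ.filter (fun x => f x < T'.card)).card := by simp only [mem_range]
    _ ≤ _ := card_lt_mono f (hT'.trans hT1)

theorem GoodCol.equiv {α β : Type} [Fintype α] [Fintype β] {r : α → α → Prop}
    {s : β → β → Prop} (h : GoodCol α r) (e : β ≃ α)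
    (hrs : ∀ x y, x ≠ y → (s x y ↔ r (e x) (e y))) : GoodCol β s := by
  obtain ⟨n, f, h1, h2, ⟨C, hC, hC'⟩, h4, h5⟩ := h
  have key : ∀ (p : α → Prop) (_ : DecidablePred p),
      (univ.filter (fun x => p (e x))).card = (univ.filter p).card := by
    intro p _
    rw [← Finset.card_map e.toEmbedding]
    congr 1
    ext x
    simp only [mem_map_equiv, mem_filter, mem_univ, true_and, Equiv.apply_symm_apply]
  refine ⟨n, fun x => f (e x), fun x => h1 _, ?_, ⟨C.map e.symm.toEmbedding, by simpa using hC, ?_⟩, ?_, ?_⟩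
  · intro x y hxy hf
    rw [hrs x y hxy]
    exact h2 _ _ (by simpa using hxy) hf
  · intro x hx y hy hxy
    rw [hrs x y hxy]
    exact hC' _ (by simpa using hx) _ (by simpa using hy) (by simpa using hxy)
  · intro i j hij
    exact ((key (fun x => f x = j) _).le.trans (h4 i j hij)).trans (key (fun x => f x = i) _).ge
  · intro S g hg
    have := h5 (S.map e.toEmbedding) (fun x => g (e.symm x)) (by
      intro x hx y hy hxy hgxy
      have hne : e.symm x ≠ e.symm y := by simpa using hxy
      have := hg (e.symm x) (by simpa using hx) (e.symm y) (by simpa using hy) hne hgxy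
      rwa [hrs _ _ hne, e.apply_symm_apply, e.apply_symm_apply] at this)
    have himg : (S.map e.toEmbedding).image (fun x => g (e.symm x)) = S.image g := by
      rw [Finset.map_eq_image, Finset.image_image]
      apply Finset.image_congr
      intro x _
      simp
    rw [himg, Finset.card_map] at this
    exact this.trans (key (fun x => f x < (S.image g).card) _).ge

theorem GoodCol.disj {α β : Type} [Fintype α] [Fintype β] {r : α → α → Prop}
    {s : β → β → Prop} {q : α ⊕ β → α ⊕ β → Prop} (h : GoodCol α r) (h' : GoodCol β s)
    (h11 : ∀ x y, q (.inl x) (.inl y) ↔ r x y) (h22 : ∀ x y, q (.inr x) (.inr y) ↔ s x y)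
    (h12 : ∀ x y, ¬ q (.inl x) (.inr y)) (h21 : ∀ x y, ¬ q (.inr x) (.inl y)) :
    GoodCol (α ⊕ β) q := by
  obtain ⟨n, f, h1, h2, ⟨C, hC, hC'⟩, h4, h5⟩ := h
  obtain ⟨m, g, k1, k2, ⟨D, hD, hD'⟩, k4, k5⟩ := h'
  refine ⟨max n m, Sum.elim f g, ?_, ?_, ?_, ?_, ?_⟩
  · rintro (x | x)
    · exact lt_max_of_lt_left (h1 x)
    · exact lt_max_of_lt_right (k1 x)
  · rintro (x | x) (y | y) hxy hf
    · rw [h11]; exact h2 x y (by simpa using hxy) hf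
    · exact h12 _ _
    · exact h21 _ _
    · rw [h22]; exact k2 x y (by simpa using hxy) hf
  · rcases le_total n m with hnm | hnm
    · refine ⟨D.map Function.Embedding.inr, by simp [hD, hnm], ?_⟩
      intro x hx y hy hxy
      simp only [mem_map, Function.Embedding.inr_apply] at hx hy
      obtain ⟨x, hx, rfl⟩ := hx
      obtain ⟨y, hy, rfl⟩ := hy
      rw [h22]; exact hD' x hx y hy (by simpa using hxy)
    · refine ⟨C.map Function.Embedding.inl, by simp [hC, hnm], ?_⟩
      intro x hx y hy hxy
      simp only [mem_map, Function.Embedding.inl_apply] at hx hy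
      obtain ⟨x, hx, rfl⟩ := hx
      obtain ⟨y, hy, rfl⟩ := hy
      rw [h11]; exact hC' x hx y hy (by simpa using hxy)
  · intro i j hij
    rw [card_filter_sum (fun x => Sum.elim f g x = j), card_filter_sum (fun x => Sum.elim f g x = i)]
    exact Nat.add_le_add (h4 i j hij) (k4 i j hij)
  · intro S c hc
    rw [card_filter_sum (fun x => Sum.elim f g x < (S.image c).card), card_sum_split S]
    refine Nat.add_le_add ?_ ?_
    · refine (h5 _ (fun a => c (.inl a)) ?_).trans (card_lt_mono f ?_)
      · intro x hx y hy hxy hcc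
        rw [← h11]
        exact hc _ (by simpa using hx) _ (by simpa using hy) (by simpa using hxy) hcc
      · apply Finset.card_le_card
        intro t ht
        simp only [mem_image, mem_filter, mem_univ, true_and] at ht ⊢
        obtain ⟨x, hx, rfl⟩ := ht
        exact ⟨_, hx, rfl⟩
    · refine (k5 _ (fun a => c (.inr a)) ?_).trans (card_lt_mono g ?_)
      · intro x hx y hy hxy hcc
        rw [← h22]
        exact hc _ (by simpa using hx) _ (by simpa using hy) (by simpa using hxy) hcc
      · apply Finset.card_le_card
        intro t ht
        simp only [mem_image, mem_filter, mem_univ, true_and] at ht ⊢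
        obtain ⟨x, hx, rfl⟩ := ht
        exact ⟨_, hx, rfl⟩

theorem GoodCol.join {α β : Type} [Fintype α] [Fintype β] {r : α → α → Prop}
    {s : β → β → Prop} {q : α ⊕ β → α ⊕ β → Prop} (h : GoodCol α r) (h' : GoodCol β s)
    (h11 : ∀ x y, q (.inl x) (.inl y) ↔ r x y) (h22 : ∀ x y, q (.inr x) (.inr y) ↔ s x y)
    (h12 : ∀ x y, q (.inl x) (.inr y)) (h21 : ∀ x y, q (.inr x) (.inl y)) :
    GoodCol (α ⊕ β) q := by
  obtain ⟨n, f, h1, h2, ⟨C, hC, hC'⟩, h4, h5⟩ := h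
  obtain ⟨m, g, k1, k2, ⟨D, hD, hD'⟩, k4, k5⟩ := h'
  refine GoodCol.of_unordered (n + m) (Sum.elim f (fun b => n + g b)) ?_ ?_ ?_ ?_
  · rintro (x | x)
    · have := h1 x
      simp only [Sum.elim_inl]; omega
    · have := k1 x
      simp only [Sum.elim_inr]; omega
  · rintro (x | x) (y | y) hxy hf
    · rw [h11]; exact h2 x y (by simpa using hxy) hf
    · have := h1 x
      simp only [Sum.elim_inl, Sum.elim_inr] at hf; omega
    · have := h1 y
      simp only [Sum.elim_inl, Sum.elim_inr] at hf; omega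
    · rw [h22]; exact k2 x y (by simpa using hxy) (by simpa using hf)
  · refine ⟨C.disjSum D, by simp [hC, hD], ?_⟩
    rintro (x | x) hx (y | y) hy hxy
    · rw [h11]; exact hC' x (by simpa using hx) y (by simpa using hy) (by simpa using hxy)
    · exact h12 _ _
    · exact h21 _ _
    · rw [h22]; exact hD' x (by simpa using hx) y (by simpa using hy) (by simpa using hxy)
  · intro S c hc
    let S1 := univ.filter (fun a => Sum.inl a ∈ S)
    let S2 := univ.filter (fun b => Sum.inr b ∈ S)
    let I1 := S1.image (fun a => c (.inl a))
    let I2 := S2.image (fun b => c (.inr b))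
    have e1 : S1.card ≤ (univ.filter (fun x => f x < I1.card)).card := by
      refine h5 S1 (fun a => c (.inl a)) ?_
      intro x hx y hy hxy hcc
      rw [← h11]
      exact hc _ (by simpa [S1] using hx) _ (by simpa [S1] using hy) (by simpa using hxy) hcc
    have e2 : S2.card ≤ (univ.filter (fun x => g x < I2.card)).card := by
      refine k5 S2 (fun a => c (.inr a)) ?_
      intro x hx y hy hxy hcc
      rw [← h22]
      exact hc _ (by simpa [S2] using hx) _ (by simpa [S2] using hy) (by simpa using hxy) hcc
    have hdisj : Disjoint I1 I2 := by
      rw [Finset.disjoint_left]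
      intro t ht1 ht2
      simp only [I1, I2, S1, S2, mem_image, mem_filter, mem_univ, true_and] at ht1 ht2
      obtain ⟨a, ha, rfl⟩ := ht1
      obtain ⟨b, hb, hab⟩ := ht2
      exact hc _ ha _ hb (by simp) hab.symm (h12 a b)
    refine ⟨range I1.card ∪ (range I2.card).image (fun t => n + t), ?_, ?_⟩
    · have hle : (I1 ∪ I2).card ≤ (S.image c).card := by
        apply Finset.card_le_card
        intro t ht
        simp only [I1, I2, S1, S2, mem_union, mem_image, mem_filter, mem_univ, true_and] at ht ⊢
        rcases ht with ⟨a, ha, rfl⟩ | ⟨a, ha, rfl⟩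
        · exact ⟨_, ha, rfl⟩
        · exact ⟨_, ha, rfl⟩
      rw [Finset.card_union_of_disjoint hdisj] at hle
      have u1 := Finset.card_union_le (range I1.card) ((range I2.card).image (fun t => n + t))
      have u2 := Finset.card_image_le (s := range I2.card) (f := fun t => n + t)
      simp only [card_range] at u1 u2
      omega
    · rw [card_sum_split S]
      refine le_trans ?_ (card_filter_sum (fun x => Sum.elim f (fun b => n + g b) x ∈
        range I1.card ∪ (range I2.card).image (fun t => n + t))).ge
      refine Nat.add_le_add (e1.trans (Finset.card_le_card ?_)) (e2.trans (Finset.card_le_card ?_))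
      · intro x hx
        simp only [mem_filter, mem_univ, true_and] at hx
        simp [hx]
      · intro x hx
        simp only [mem_filter, mem_univ, true_and] at hx
        simp [hx]

theorem GoodCol.single {α : Type} [Fintype α] (r : α → α → Prop) (h : ∃ a : α, ∀ b : α, b = a) :
    GoodCol α r := by
  obtain ⟨a, ha⟩ := h
  refine ⟨1, fun _ => 0, by simp, ?_, ⟨{a}, by simp, ?_⟩, ?_, ?_⟩
  · intro x y hxy
    exact absurd ((ha x).trans (ha y).symm) hxy
  · intro x _ y _ hxy
    exact absurd ((ha x).trans (ha y).symm) hxy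
  · intro i j hij
    apply Finset.card_le_card
    intro x
    simp only [mem_filter, mem_univ, true_and]
    omega
  · intro S g _
    apply Finset.card_le_card
    intro x hx
    simp only [mem_filter, mem_univ, true_and]
    exact Finset.card_pos.2 ⟨g x, Finset.mem_image_of_mem g hx⟩

/-- Comparability. -/
def relD (α : Type) [PartialOrder α] (x y : α) : Prop := x ≤ y ∨ y ≤ x
/-- Incomparability. -/
def relC (α : Type) [PartialOrder α] (x y : α) : Prop := ¬ (x ≤ y ∨ y ≤ x)

theorem sp_good (α : Type) [inst : PartialOrder α] (h : IsSeriesParallel α) :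
    ∃ _ : Fintype α, GoodCol α (relD α) ∧ GoodCol α (relC α) := by
  induction h with
  | single α h =>
    obtain ⟨a, ha⟩ := h
    let _ : Fintype α := ⟨{a}, fun b => by simp [ha b]⟩
    refine ⟨inferInstance, ?_⟩
    exact ⟨GoodCol.single _ ⟨a, ha⟩, GoodCol.single _ ⟨a, ha⟩⟩
  | parallel α β _ _ ih1 ih2 =>
    obtain ⟨_, a1, a2⟩ := ih1
    obtain ⟨_, b1, b2⟩ := ih2
    refine ⟨inferInstance, GoodCol.disj a1 b1 ?_ ?_ ?_ ?_, GoodCol.join a2 b2 ?_ ?_ ?_ ?_⟩ <;>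
      intro x y <;> simp [relD, relC]
  | series α β _ _ ih1 ih2 =>
    obtain ⟨_, a1, a2⟩ := ih1
    obtain ⟨_, b1, b2⟩ := ih2
    let : Fintype (α ⊕ₗ β) := inferInstanceAs (Fintype (α ⊕ β))
    refine ⟨inferInstance, ?_, ?_⟩
    · refine (GoodCol.join (q := fun x y => relD (α ⊕ₗ β) (toLex x) (toLex y))
        a1 b1 ?_ ?_ ?_ ?_).equiv ofLex ?_
      all_goals intro x y
      all_goals simp [relD]
    · refine (GoodCol.disj (q := fun x y => relC (α ⊕ₗ β) (toLex x) (toLex y))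
        a2 b2 ?_ ?_ ?_ ?_).equiv ofLex ?_
      all_goals intro x y
      all_goals simp [relC]
  | iso α β _ he ih =>
    obtain ⟨_, a1, a2⟩ := ih
    obtain ⟨e⟩ := he
    refine ⟨Fintype.ofEquiv α e.symm.toEquiv, ?_⟩
    let := Fintype.ofEquiv α e.symm.toEquiv
    refine ⟨a1.equiv e.toEquiv ?_, a2.equiv e.toEquiv ?_⟩ <;>
      intro x y _ <;> simp [relD, relC]

theorem GoodCol.finish {α : Type} [Fintype α] {r : α → α → Prop} (h : GoodCol α r)
    (I K : Set α → Prop)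
    (hI : ∀ s, I s ↔ ∀ x ∈ s, ∀ y ∈ s, x ≠ y → ¬ r x y)
    (hK : ∀ s : Set α, (∀ x ∈ s, ∀ y ∈ s, x ≠ y → r x y) → K s) :
    ∃ A : Fin (sSup {n | ∃ C : Set α, K C ∧ C.ncard = n}) → Set α,
    (∀ i, I (A i)) ∧
    (∀ i j, i ≠ j → Disjoint (A i) (A j)) ∧
    (⋃ i, A i) = Set.univ ∧
    ∀ k, k ≤ (sSup {n | ∃ C : Set α, K C ∧ C.ncard = n}) →
      (⋃ i : Fin (sSup {n | ∃ C : Set α, K C ∧ C.ncard = n}), ⋃ (_ : (i : ℕ) < k), A i).ncard =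
      sSup {n | ∃ A : Fin k → Set α, (∀ i, I (A i)) ∧ (⋃ i, A i).ncard = n} := by
  obtain ⟨n, f, h1, h2, ⟨C, hC, hC'⟩, h4, h5⟩ := h
  have hbd : ∀ s : Set α, s.ncard ≤ Fintype.card α := by
    intro s
    rw [← Nat.card_eq_fintype_card]
    exact Set.ncard_le_card s
  have hn : n ≤ sSup {n | ∃ C : Set α, K C ∧ C.ncard = n} := by
    apply le_csSup
    · refine ⟨Fintype.card α, ?_⟩
      rintro _ ⟨s, _, rfl⟩
      exact hbd s
    · exact ⟨C, hK _ (by simpa using hC'), by simpa using hC⟩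
  generalize sSup {n | ∃ C : Set α, K C ∧ C.ncard = n} = N at hn
  have hcls : ∀ i, I {x | f x = i} := by
    intro i
    rw [hI]
    intro x hx y hy hxy
    exact h2 x y hxy (hx.trans hy.symm)
  refine ⟨fun i => {x | f x = i}, fun i => hcls i, ?_, ?_, ?_⟩
  · intro i j hij
    rw [Set.disjoint_left]
    intro x hx hy
    exact hij (Fin.ext (hx.symm.trans hy))
  · ext x
    simp only [Set.mem_iUnion, Set.mem_univ, iff_true]
    exact ⟨⟨f x, (h1 x).trans_le hn⟩, rfl⟩
  · intro k hk
    have hU : (⋃ i : Fin N, ⋃ (_ : (i : ℕ) < k), {x | f x = i}) = {x | f x < k} := by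
      ext x
      simp only [Set.mem_iUnion, Set.mem_ofPred_eq]
      constructor
      · rintro ⟨i, hi, hx⟩; omega
      · intro hx; exact ⟨⟨f x, by omega⟩, hx, rfl⟩
    rw [hU]
    apply le_antisymm
    · apply le_csSup
      · refine ⟨Fintype.card α, ?_⟩
        rintro _ ⟨s, _, rfl⟩
        exact hbd _
      · refine ⟨fun i => {x | f x = i}, fun i => hcls i, ?_⟩
        congr 1
        ext x
        simp only [Set.mem_iUnion, Set.mem_ofPred_eq]
        constructor
        · rintro ⟨i, hx⟩; omega
        · intro hx; exact ⟨⟨f x, by omega⟩, rfl⟩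
    · apply csSup_le
      · refine ⟨_, fun i => {x | f x = i}, fun i => hcls i, rfl⟩
      rintro _ ⟨A, hA, rfl⟩
      let g : α → ℕ := fun x => if h : ∃ i, x ∈ A i then (h.choose : Fin k) else 0
      have hg : ∀ x ∈ ⋃ i, A i, ∃ i : Fin k, g x = i ∧ x ∈ A i := by
        intro x hx
        have hx' : ∃ i, x ∈ A i := by simpa using hx
        refine ⟨hx'.choose, ?_, hx'.choose_spec⟩
        simp only [g]
        rw [dif_pos hx']
      have := h5 (⋃ i, A i).toFinset g (by
        intro x hx y hy hxy hgg
        obtain ⟨i, hi, hxi⟩ := hg x (by simpa using hx)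
        obtain ⟨j, hj, hyj⟩ := hg y (by simpa using hy)
        have hij : i = j := Fin.ext (by omega)
        subst hij
        exact (hI _).1 (hA i) x hxi y hyj hxy)
      rw [Set.ncard_eq_toFinset_card', Set.ncard_eq_toFinset_card']
      refine this.trans ((card_lt_mono f (j := k) ?_).trans (le_of_eq ?_))
      · have hsub : (⋃ i, A i).toFinset.image g ⊆ range k := by
          intro t ht
          simp only [mem_image, Set.mem_toFinset] at ht
          obtain ⟨x, hx, rfl⟩ := ht
          obtain ⟨i, hi, _⟩ := hg x hx
          rw [mem_range, hi]; exact i.2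
        simpa using Finset.card_le_card hsub
      · congr 1
        ext x; simp

theorem dDec_of_good (α : Type) [PartialOrder α] [Fintype α] (h : GoodCol α (relD α)) :
    DDecomposable α := by
  refine h.finish (IsAntichain (· ≤ ·)) (IsChain (· ≤ ·)) ?_ ?_
  · intro s
    constructor
    · intro hs x hx y hy hxy hr
      rcases hr with hr | hr
      · exact hs hx hy hxy hr
      · exact hs hy hx hxy.symm hr
    · intro hs x hx y hy hxy hr
      exact hs x hx y hy hxy (Or.inl hr)
  · intro s hs x hx y hy hxy
    exact hs x hx y hy hxy

theorem cDec_of_good (α : Type) [PartialOrder α] [Fintype α] (h : GoodCol α (relC α)) :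
    CDecomposable α := by
  refine h.finish (IsChain (· ≤ ·)) (IsAntichain (· ≤ ·)) ?_ ?_
  · intro s
    constructor
    · intro hs x hx y hy hxy hr
      exact hr (hs hx hy hxy)
    · intro hs x hx y hy hxy
      exact not_not.1 (hs x hx y hy hxy)
  · intro s hs x hx y hy hxy hr
    exact hs x hx y hy hxy (Or.inl hr)

theorem sp_main (α : Type) [PartialOrder α] [Fintype α] (h : IsSeriesParallel α) :
    DDecomposable α ∧ CDecomposable α := by
  obtain ⟨_, h1, h2⟩ := sp_good α h
  exact ⟨dDec_of_good α h1, cDec_of_good α h2⟩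

theorem sp_split_par (α : Type) [PartialOrder α] (p : α → Prop)
    (h1 : IsSeriesParallel {x // p x}) (h2 : IsSeriesParallel {x // ¬ p x})
    (hx : ∀ x y, p x → ¬ p y → ¬ x ≤ y ∧ ¬ y ≤ x) : IsSeriesParallel α := by
  refine IsSeriesParallel.iso _ α (IsSeriesParallel.parallel _ _ h1 h2) ⟨OrderIso.symm
    { toEquiv := Equiv.sumCompl p, map_rel_iff' := ?_ }⟩
  rintro (⟨a, ha⟩ | ⟨a, ha⟩) (⟨b, hb⟩ | ⟨b, hb⟩)
  · simp
  · simp [(hx a b ha hb).1]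
  · simp [(hx b a hb ha).2]
  · simp

theorem sp_split_ser (α : Type) [PartialOrder α] (p : α → Prop)
    (h1 : IsSeriesParallel {x // p x}) (h2 : IsSeriesParallel {x // ¬ p x})
    (hx : ∀ x y, p x → ¬ p y → x < y) : IsSeriesParallel α := by
  refine IsSeriesParallel.iso _ α (IsSeriesParallel.series _ _ h1 h2) ⟨OrderIso.symm
    { toEquiv := ofLex.trans (Equiv.sumCompl p), map_rel_iff' := ?_ }⟩
  intro a b
  obtain ⟨a, rfl⟩ := toLex.surjective a
  obtain ⟨b, rfl⟩ := toLex.surjective b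
  rcases a with ⟨a, ha⟩ | ⟨a, ha⟩ <;> rcases b with ⟨b, hb⟩ | ⟨b, hb⟩
  · simp
  · simp [(hx a b ha hb).le]
  · simp [(hx b a hb ha).not_ge]
  · simp

theorem weak_sp (n : ℕ) : ∀ (α : Type) [PartialOrder α] [Fintype α], Fintype.card α ≤ n →
    Nonempty α → IsWeakOrder α → IsSeriesParallel α := by
  induction n with
  | zero =>
    intro α _ _ hc hne _
    have := Fintype.card_pos (α := α)
    omega
  | succ n ih =>
    rintro α _ _ hc ⟨a⟩ ⟨f, hf⟩
    have sub : ∀ p : α → Prop, (∃ x, p x) → (∃ x, ¬ p x) → IsSeriesParallel {x // p x} := by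
      rintro p ⟨x, hx⟩ ⟨y, hy⟩
      refine ih _ ?_ ⟨⟨x, hx⟩⟩ ⟨fun z => f z.1, fun u v => ?_⟩
      · have := Fintype.card_subtype_lt (p := p) hy
        omega
      · exact (hf u.1 v.1)
    by_cases hs : ∀ b, b = a
    · exact IsSeriesParallel.single α ⟨a, hs⟩
    push Not at hs
    obtain ⟨b, hb⟩ := hs
    by_cases hconst : ∀ x y, f x = f y
    · refine sp_split_par α (fun x => x = a) (sub _ ⟨a, rfl⟩ ⟨b, hb⟩)
        (sub _ ⟨b, hb⟩ ⟨a, by simp⟩) ?_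
      intro x y hx hy
      have hxy : x ≠ y := by rintro rfl; exact hy hx
      constructor
      · intro hle
        have := (hf x y).1 (lt_of_le_of_ne hle hxy)
        have := hconst x y
        omega
      · intro hle
        have := (hf y x).1 (lt_of_le_of_ne hle hxy.symm)
        have := hconst x y
        omega
    · push Not at hconst
      obtain ⟨x, y, hxy⟩ := hconst
      wlog hlt : f x < f y generalizing x y
      · exact this y x hxy.symm (by omega)
      refine sp_split_ser α (fun z => f z ≤ f x) (sub _ ⟨x, le_rfl⟩ ⟨y, by omega⟩)
        (sub _ ⟨y, by omega⟩ ⟨x, by simp⟩) ?_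
      intro u v hu hv
      exact (hf u v).2 (by omega)

theorem good_empty (α : Type) [Fintype α] [IsEmpty α] (r : α → α → Prop) : GoodCol α r := by
  refine ⟨0, fun _ => 0, fun x => isEmptyElim x, fun x => isEmptyElim x,
    ⟨∅, by simp, by simp⟩, by simp, ?_⟩
  intro S g _
  simp [Finset.eq_empty_of_isEmpty S]

end Helpers

/-- Every finite series-parallel poset is both d-decomposable and
c-decomposable; in particular, every finite weak order is both
d-decomposable and c-decomposable. -/
theorem seriesParallel_dDecomposable_cDecomposable :
    (∀ (α : Type) [PartialOrder α] [Fintype α],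
      IsSeriesParallel α → DDecomposable α ∧ CDecomposable α) ∧
    (∀ (α : Type) [PartialOrder α] [Fintype α],
      IsWeakOrder α → DDecomposable α ∧ CDecomposable α) := by
  refine ⟨fun α _ _ h => sp_main α h, ?_⟩
  intro α _ _ h
  rcases isEmpty_or_nonempty α with he | he
  · exact ⟨dDec_of_good α (good_empty α _), cDec_of_good α (good_empty α _)⟩
  · exact sp_main α (weak_sp _ α le_rfl he h)
end

section
/- There exist finite posets P and Q such that the maximum size of a semichain in the product P×Q is strictly smaller than the minimum number of uniantichains needed to cover P×Q. (This answers a question of Trotter and West in the negative.) -/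
/-- A *uniantichain* in the product of two posets: an antichain of the form
`{p} × A` or `A × {q}`. -/
def IsUniantichain {α β : Type*} [PartialOrder α] [PartialOrder β] (U : Set (α × β)) : Prop :=
  (∃ (p : α) (A : Set β), IsAntichain (· ≤ ·) A ∧ U = ({p} : Set α) ×ˢ A) ∨
  (∃ (q : β) (A : Set α), IsAntichain (· ≤ ·) A ∧ U = A ×ˢ ({q} : Set β))

/-- A *semichain*: no two distinct elements lie in a common uniantichain. -/
def IsSemichain {α β : Type*} [PartialOrder α] [PartialOrder β] (T : Set (α × β)) : Prop :=
  ∀ x ∈ T, ∀ y ∈ T, x ≠ y → ∀ U : Set (α × β), IsUniantichain U → ¬(x ∈ U ∧ y ∈ U)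

/-- The maximum size of a semichain in `α × β`. -/
noncomputable def maxSemichain (α β : Type*) [PartialOrder α] [PartialOrder β] : ℕ :=
  sSup {n | ∃ T : Set (α × β), IsSemichain T ∧ T.ncard = n}

/-- The minimum number of uniantichains needed to cover `α × β`. -/
noncomputable def minUniantichainCover (α β : Type*) [PartialOrder α] [PartialOrder β] : ℕ :=
  sInf {n | ∃ U : Fin n → Set (α × β), (∀ i, IsUniantichain (U i)) ∧ (⋃ i, U i) = Set.univ}

/-! ### The two seven-element posets

The fractional covering/packing number of the product is `35 / 2`; hence semichains have
at most `17` elements while coverings need at least `18` uniantichains. -/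

/-- Elements strictly below `i` in the first poset. -/
def belowA : Fin 7 → List (Fin 7) :=
  ![[], [], [], [1, 2], [0, 1, 2, 3], [1, 2, 3], [1, 2]]

/-- Elements strictly below `i` in the second poset. -/
def belowB : Fin 7 → List (Fin 7) :=
  ![[], [], [], [2], [1, 2, 3], [0, 1, 2, 3, 4], [2, 3]]

/-- The first poset. -/
@[reducible] def posetA : PartialOrder (Fin 7) where
  le i j := i = j ∨ i ∈ belowA j
  lt i j := (i = j ∨ i ∈ belowA j) ∧ ¬ (j = i ∨ j ∈ belowA i)
  lt_iff_le_not_ge _ _ := Iff.rfl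
  le_refl i := Or.inl rfl
  le_trans := by decide +kernel
  le_antisymm := by decide +kernel

/-- The second poset. -/
@[reducible] def posetB : PartialOrder (Fin 7) where
  le i j := i = j ∨ i ∈ belowB j
  lt i j := (i = j ∨ i ∈ belowB j) ∧ ¬ (j = i ∨ j ∈ belowB i)
  lt_iff_le_not_ge _ _ := Iff.rfl
  le_refl i := Or.inl rfl
  le_trans := by decide +kernel
  le_antisymm := by decide +kernel

/-- Twice the optimal fractional packing. -/
def wt : Fin 7 → Fin 7 → ℕ :=
  ![![2, 0, 0, 0, 0, 0, 0], ![0, 0, 2, 2, 0, 0, 2], ![0, 2, 0, 0, 2, 2, 0], ![0, 0, 2, 2, 2, 2, 0],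
    ![1, 0, 1, 1, 1, 2, 0], ![0, 1, 1, 1, 1, 0, 1], ![0, 1, 0, 0, 0, 0, 1]]

/-- Row uniantichains of twice the optimal fractional covering. -/
def rowCl : List (Fin 7 × List (Fin 7)) :=
  [(0, [0, 1, 6]), (1, [0, 1, 3]), (1, [0, 4, 6]), (2, [0, 1, 3]), (2, [0, 4, 6]),
   (3, [0, 1, 2]), (3, [0, 1, 3]), (3, [0, 4, 6]), (3, [5, 6]), (4, [0, 1, 2]),
   (4, [0, 4, 6]), (5, [0, 1, 2]), (5, [0, 4, 6]), (6, [0, 1, 6])]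

/-- Column uniantichains of twice the optimal fractional covering. -/
def colCl : List (Fin 7 × List (Fin 7)) :=
  [(0, [0, 3, 6]), (1, [0, 1, 2]), (1, [4, 5, 6]), (2, [0, 1, 2]), (2, [0, 1, 2]),
   (2, [0, 3, 6]), (2, [4, 5, 6]), (3, [0, 1, 2]), (3, [0, 3, 6]), (3, [4, 5, 6]),
   (3, [4, 5, 6]), (4, [0, 1, 2]), (4, [0, 3, 6]), (4, [4, 5, 6]), (5, [0, 1, 2]),
   (5, [0, 1, 2]), (5, [0, 3, 6]), (5, [4, 5, 6]), (5, [4, 5, 6]), (6, [0, 1, 2]),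
   (6, [4, 5, 6])]

/-- The doubled fractional covering as a list of sets. -/
def cls : List (Finset (Fin 7 × Fin 7)) :=
  rowCl.map (fun c => ({c.1} : Finset (Fin 7)) ×ˢ c.2.toFinset) ++ colCl.map (fun c => c.2.toFinset ×ˢ ({c.1} : Finset (Fin 7)))

lemma row_anti : ∀ c ∈ rowCl, ∀ x ∈ c.2, ∀ y ∈ c.2, x ≠ y → ¬ (x = y ∨ x ∈ belowB y) := by
  decide +kernel

lemma col_anti : ∀ c ∈ colCl, ∀ x ∈ c.2, ∀ y ∈ c.2, x ≠ y → ¬ (x = y ∨ x ∈ belowA y) := by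
  decide +kernel

lemma cls_uni : ∀ U ∈ cls, @IsUniantichain (Fin 7) (Fin 7) posetA posetB (U : Set (Fin 7 × Fin 7)) := by
  intro U hU
  rcases List.mem_append.1 hU with h | h
  · obtain ⟨c, hc, rfl⟩ := List.mem_map.1 h
    refine Or.inl ⟨c.1, (c.2.toFinset : Set (Fin 7)), ?_, Finset.coe_product _ _ |>.trans (by rw [Finset.coe_singleton])⟩
    intro x hx y hy hxy
    exact row_anti c hc x (by simpa using hx) y (by simpa using hy) hxy
  · obtain ⟨c, hc, rfl⟩ := List.mem_map.1 h
    refine Or.inr ⟨c.1, (c.2.toFinset : Set (Fin 7)), ?_, Finset.coe_product _ _ |>.trans (by rw [Finset.coe_singleton])⟩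
    intro x hx y hy hxy
    exact col_anti c hc x (by simpa using hx) y (by simpa using hy) hxy

lemma cls_length : cls.length = 35 := by simp [cls, rowCl, colCl]

lemma cls_cover : ∀ x : Fin 7 × Fin 7, 2 ≤ (cls.map (fun U => if x ∈ U then 1 else 0)).sum := by
  decide +kernel

/-- Every semichain has at most `17` elements. -/
lemma semichain_le (T : Set (Fin 7 × Fin 7)) (hT : @IsSemichain (Fin 7) (Fin 7) posetA posetB T) :
    T.ncard ≤ 17 := by
  classical
  set S : Finset (Fin 7 × Fin 7) := T.toFinset with hS
  have hc : T.ncard = S.card := Set.ncard_eq_toFinset_card' T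
  have h1 : ∀ L : List (Finset (Fin 7 × Fin 7)), (∀ U ∈ L, U ∈ cls) →
      ∑ x ∈ S, (L.map (fun U => if x ∈ U then 1 else 0)).sum ≤ L.length := by
    intro L
    induction L with
    | nil => simp
    | cons U L ih =>
      intro h
      have hL := ih (fun V hV => h V (List.mem_cons_of_mem _ hV))
      have hU := cls_uni U (h U List.mem_cons_self)
      have hle : ∑ x ∈ S, (if x ∈ U then 1 else 0) ≤ 1 := by
        rw [← Finset.card_filter, Finset.card_le_one]
        intro a ha b hb
        by_contra hab
        rw [Finset.mem_filter] at ha hb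
        exact hT a (by simpa [hS] using ha.1) b (by simpa [hS] using hb.1) hab _ hU ⟨ha.2, hb.2⟩
      simp only [List.map_cons, List.sum_cons, Finset.sum_add_distrib, List.length_cons]
      omega
  have h2 := h1 cls (fun _ h => h)
  have h3 : S.card * 2 ≤ ∑ x ∈ S, (cls.map (fun U => if x ∈ U then 1 else 0)).sum := by
    rw [← smul_eq_mul]
    exact Finset.card_nsmul_le_sum _ _ _ (fun x _ => cls_cover x)
  rw [cls_length] at h2
  omega

lemma row_wt : ∀ p : Fin 7, ∀ A : Finset (Fin 7),
    (∀ x ∈ A, ∀ y ∈ A, x ≠ y → ¬ (x = y ∨ x ∈ belowB y)) → ∑ q ∈ A, wt p q ≤ 2 := by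
  decide +kernel

lemma col_wt : ∀ q : Fin 7, ∀ A : Finset (Fin 7),
    (∀ x ∈ A, ∀ y ∈ A, x ≠ y → ¬ (x = y ∨ x ∈ belowA y)) → ∑ p ∈ A, wt p q ≤ 2 := by
  decide +kernel

lemma total_wt : ∑ x : Fin 7 × Fin 7, wt x.1 x.2 = 35 := by decide +kernel

open Classical in
/-- Every uniantichain has weight at most `2`. -/
lemma uni_wt (U : Set (Fin 7 × Fin 7)) (hU : @IsUniantichain (Fin 7) (Fin 7) posetA posetB U) :
    ∑ x, (if x ∈ U then wt x.1 x.2 else 0) ≤ 2 := by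
  rcases hU with ⟨p, A, hA, rfl⟩ | ⟨q, A, hA, rfl⟩
  · have := row_wt p A.toFinset (fun x hx y hy hxy => hA (by simpa using hx) (by simpa using hy) hxy)
    rw [Fintype.sum_prod_type, Finset.sum_eq_single p]
    · refine le_of_eq_of_le ?_ this
      have e : A.toFinset = Finset.univ.filter (fun y => y ∈ A) := by ext; simp
      rw [e, Finset.sum_filter]
      refine Finset.sum_congr rfl (fun y _ => ?_)
      by_cases hy : y ∈ A <;> simp [hy]
    · intro b _ hb
      simp [hb]
    · simp
  · have := col_wt q A.toFinset (fun x hx y hy hxy => hA (by simpa using hx) (by simpa using hy) hxy)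
    rw [Fintype.sum_prod_type_right, Finset.sum_eq_single q]
    · refine le_of_eq_of_le ?_ this
      have e : A.toFinset = Finset.univ.filter (fun y => y ∈ A) := by ext; simp
      rw [e, Finset.sum_filter]
      refine Finset.sum_congr rfl (fun y _ => ?_)
      by_cases hy : y ∈ A <;> simp [hy]
    · intro b _ hb
      simp [hb]
    · simp

/-- Every uniantichain covering has at least `18` members. -/
lemma le_cover (n : ℕ) (U : Fin n → Set (Fin 7 × Fin 7))
    (hU : ∀ i, @IsUniantichain (Fin 7) (Fin 7) posetA posetB (U i))
    (hc : (⋃ i, U i) = Set.univ) : 18 ≤ n := by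
  classical
  have h1 : ∑ x : Fin 7 × Fin 7, wt x.1 x.2 ≤
      ∑ x : Fin 7 × Fin 7, ∑ i, (if x ∈ U i then wt x.1 x.2 else 0) := by
    refine Finset.sum_le_sum (fun x _ => ?_)
    have hx : x ∈ ⋃ i, U i := by rw [hc]; trivial
    obtain ⟨i, hi⟩ := Set.mem_iUnion.1 hx
    calc wt x.1 x.2 = (if x ∈ U i then wt x.1 x.2 else 0) := by rw [if_pos hi]
      _ ≤ _ := Finset.single_le_sum (f := fun i => if x ∈ U i then wt x.1 x.2 else 0)
        (fun _ _ => Nat.zero_le _) (Finset.mem_univ i)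
  rw [Finset.sum_comm] at h1
  have h2 : ∑ i, ∑ x, (if x ∈ U i then wt x.1 x.2 else 0) ≤ ∑ _i : Fin n, 2 :=
    Finset.sum_le_sum (fun i _ => by convert uni_wt (U i) (hU i))
  rw [total_wt] at h1
  simp at h2
  omega

lemma cover_nonempty : ∃ n, ∃ U : Fin n → Set (Fin 7 × Fin 7),
    (∀ i, @IsUniantichain (Fin 7) (Fin 7) posetA posetB (U i)) ∧ (⋃ i, U i) = Set.univ := by
  let e := Fintype.equivFin (Fin 7 × Fin 7)
  refine ⟨_, fun i => {e.symm i}, fun i => Or.inl ⟨(e.symm i).1, {(e.symm i).2}, ?_, ?_⟩, ?_⟩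
  · intro x hx y hy hxy
    exact absurd (hx.trans hy.symm) hxy
  · simp
  · ext x
    simp only [Set.mem_iUnion, Set.mem_singleton_iff, Set.mem_univ, iff_true]
    exact ⟨e x, by simp⟩

/-- There exist finite posets `P` and `Q` such that the maximum size of a
semichain in `P × Q` is strictly smaller than the minimum number of
uniantichains needed to cover `P × Q` (answering a question of Trotter and
West in the negative). -/
theorem trotter_west_question_false :
    ∃ (α β : Type) (ia : PartialOrder α) (ib : PartialOrder β)
      (_ : Fintype α) (_ : Fintype β),
      @maxSemichain α β ia ib < @minUniantichainCover α β ia ib := by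
  refine ⟨Fin 7, Fin 7, posetA, posetB, inferInstance, inferInstance, ?_⟩
  have h1 : @maxSemichain (Fin 7) (Fin 7) posetA posetB ≤ 17 := by
    refine csSup_le' ?_
    rintro n ⟨T, hT, rfl⟩
    exact semichain_le T hT
  have h2 : 18 ≤ @minUniantichainCover (Fin 7) (Fin 7) posetA posetB := by
    refine le_csInf cover_nonempty ?_
    rintro n ⟨U, hU, hc⟩
    exact le_cover n U hU hc
  omega
end

section
/- If a finite poset P is both c-decomposable and d-decomposable and a finite poset Q is c-decomposable, then the maximum size of a semichain in P×Q equals the minimum number of uniantichains needed to cover P×Q, and this common value equals ∑_{i=1}^{min(w(P),w(Q))} λ_i^P·λ_i^Q = ∑_{j=1}^{h(P)} c_{μ_j^P}(Q). -/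
open Finset in
/-- Weighted bipartite matching duality (Egerváry), from Hall's theorem. -/
theorem egervary_perm {ι : Type*} [Fintype ι] [DecidableEq ι] (E : ι → ι → Prop)
    (w : ι → ι → ℤ) (hE : ∀ i, E i i) :
    ∃ u v : ι → ℤ, (∀ i j, E i j → w i j ≤ u i + v j) ∧
      ∃ σ : Equiv.Perm ι, ∀ i, E i (σ i) ∧ w i (σ i) = u i + v (σ i) := by
  classical
  let Feas : (ι → ℤ) × (ι → ℤ) → Prop := fun x => ∀ i j, E i j → w i j ≤ x.1 i + x.2 j
  let val : (ι → ℤ) × (ι → ℤ) → ℤ := fun x => ∑ i, x.1 i + ∑ i, x.2 i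
  have hbd : ∀ x, Feas x → ∑ i, w i i ≤ val x := by
    intro x hx
    simp only [val, ← Finset.sum_add_distrib]
    exact Finset.sum_le_sum fun i _ => hx i i (hE i)
  have hne : ∃ x, Feas x := by
    refine ⟨(fun i => ∑ j, |w i j|, fun _ => 0), fun i j _ => ?_⟩
    simp only [add_zero]
    exact (le_abs_self _).trans
      (Finset.single_le_sum (f := fun j => |w i j|) (fun _ _ => abs_nonneg _) (mem_univ j))
  obtain ⟨z, ⟨x, hx, rfl⟩, hmin⟩ := Int.exists_least_of_bdd
    (P := fun z => ∃ x, Feas x ∧ val x = z)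
    ⟨∑ i, w i i, by rintro z ⟨x, hx, rfl⟩; exact hbd x hx⟩
    (by obtain ⟨x, hx⟩ := hne; exact ⟨_, x, hx, rfl⟩)
  obtain ⟨u, v⟩ := x
  refine ⟨u, v, hx, ?_⟩
  let t : ι → Finset ι := fun i => univ.filter fun j => E i j ∧ w i j = u i + v j
  have hall : ∀ s : Finset ι, s.card ≤ (s.biUnion t).card := by
    intro s
    by_contra hlt
    push Not at hlt
    have hf : Feas (fun i => u i - if i ∈ s then 1 else 0,
        fun j => v j + if j ∈ s.biUnion t then 1 else 0) := by
      intro i j hij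
      have h1 := hx i j hij
      simp only at h1 ⊢
      by_cases hi : i ∈ s
      · by_cases hj : j ∈ s.biUnion t
        · simp only [hi, hj, if_true]; linarith
        · have : w i j ≠ u i + v j := by
            intro h
            exact hj (mem_biUnion.2 ⟨i, hi, by simp [t, hij, h]⟩)
          simp only [hi, hj, if_true, if_false]
          omega
      · simp only [hi, if_false]
        split_ifs <;> linarith
    have := hmin _ ⟨_, hf, rfl⟩
    simp only [val, Finset.sum_sub_distrib, Finset.sum_add_distrib, Finset.sum_ite_mem,
      Finset.univ_inter, Finset.sum_const, nsmul_eq_mul, mul_one] at this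
    have h2 : ((s.biUnion t).card : ℤ) < s.card := by exact_mod_cast hlt
    linarith
  obtain ⟨f, hf, hft⟩ := (Finset.all_card_le_biUnion_card_iff_exists_injective t).1 hall
  refine ⟨Equiv.ofBijective f (Finite.injective_iff_bijective.1 hf), fun i => ?_⟩
  have := hft i
  simpa [t] using this

theorem bdd_ncard {ι α : Type*} [Finite α] (p : ι → Prop) (f : ι → Set α) :
    BddAbove {n | ∃ x, p x ∧ (f x).ncard = n} := by
  refine ⟨Nat.card α, ?_⟩
  rintro n ⟨x, -, rfl⟩
  exact Set.ncard_le_card _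

theorem le_ck {α : Type*} [Finite α] [PartialOrder α] {k : ℕ} (C : Fin k → Set α)
    (hC : ∀ i, IsChain (· ≤ ·) (C i)) : (⋃ i, C i).ncard ≤ ck α k :=
  le_csSup (bdd_ncard (fun C : Fin k → Set α => ∀ i, IsChain (· ≤ ·) (C i)) (fun C => ⋃ i, C i))
    ⟨C, hC, rfl⟩

theorem le_dk {α : Type*} [Finite α] [PartialOrder α] {k : ℕ} (C : Fin k → Set α)
    (hC : ∀ i, IsAntichain (· ≤ ·) (C i)) : (⋃ i, C i).ncard ≤ dk α k :=
  le_csSup (bdd_ncard (fun C : Fin k → Set α => ∀ i, IsAntichain (· ≤ ·) (C i))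
    (fun C => ⋃ i, C i)) ⟨C, hC, rfl⟩

theorem exists_ck {α : Type*} [Finite α] [PartialOrder α] (k : ℕ) :
    ∃ C : Fin k → Set α, (∀ i, IsChain (· ≤ ·) (C i)) ∧ (⋃ i, C i).ncard = ck α k :=
  Nat.sSup_mem (s := {n | ∃ C : Fin k → Set α, (∀ i, IsChain (· ≤ ·) (C i)) ∧
      (⋃ i, C i).ncard = n})
    ⟨_, fun _ => ∅, fun _ => by simp [IsChain], rfl⟩
    (bdd_ncard (fun C : Fin k → Set α => ∀ i, IsChain (· ≤ ·) (C i)) (fun C => ⋃ i, C i))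

theorem exists_dk {α : Type*} [Finite α] [PartialOrder α] (k : ℕ) :
    ∃ C : Fin k → Set α, (∀ i, IsAntichain (· ≤ ·) (C i)) ∧ (⋃ i, C i).ncard = dk α k :=
  Nat.sSup_mem (s := {n | ∃ C : Fin k → Set α, (∀ i, IsAntichain (· ≤ ·) (C i)) ∧
      (⋃ i, C i).ncard = n})
    ⟨_, fun _ => ∅, fun _ => by simp [IsAntichain], rfl⟩
    (bdd_ncard (fun C : Fin k → Set α => ∀ i, IsAntichain (· ≤ ·) (C i)) (fun C => ⋃ i, C i))

theorem ck_mono (α : Type*) [Finite α] [PartialOrder α] : Monotone (ck α) := by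
  refine monotone_nat_of_le_succ fun k => ?_
  obtain ⟨C, hC, h⟩ := exists_ck (α := α) k
  rw [← h]
  refine le_trans (Set.ncard_le_ncard ?_ (Set.toFinite _)) (le_ck (Fin.snoc C ∅ : Fin (k+1) → Set α) ?_)
  · refine Set.iUnion_subset fun i => ?_
    have := Set.subset_iUnion (Fin.snoc C ∅ : Fin (k+1) → Set α) i.castSucc
    simpa using this
  · intro i
    refine Fin.lastCases ?_ (fun i => ?_) i
    · simp [IsChain]
    · simpa using hC i

theorem dk_mono (α : Type*) [Finite α] [PartialOrder α] : Monotone (dk α) := by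
  refine monotone_nat_of_le_succ fun k => ?_
  obtain ⟨C, hC, h⟩ := exists_dk (α := α) k
  rw [← h]
  refine le_trans (Set.ncard_le_ncard ?_ (Set.toFinite _)) (le_dk (Fin.snoc C ∅ : Fin (k+1) → Set α) ?_)
  · refine Set.iUnion_subset fun i => ?_
    have := Set.subset_iUnion (Fin.snoc C ∅ : Fin (k+1) → Set α) i.castSucc
    simpa using this
  · intro i
    refine Fin.lastCases ?_ (fun i => ?_) i
    · simp [IsAntichain]
    · simpa using hC i

theorem ck_zero (α : Type*) [Finite α] [PartialOrder α] : ck α 0 = 0 := by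
  obtain ⟨C, hC, h⟩ := exists_ck (α := α) 0
  rw [← h]; simp

theorem dk_zero (α : Type*) [Finite α] [PartialOrder α] : dk α 0 = 0 := by
  obtain ⟨C, hC, h⟩ := exists_dk (α := α) 0
  rw [← h]; simp

theorem ck_le_card (α : Type*) [Finite α] [PartialOrder α] (k : ℕ) : ck α k ≤ Nat.card α := by
  obtain ⟨C, hC, h⟩ := exists_ck (α := α) k
  rw [← h]; exact Set.ncard_le_card _

theorem dk_le_card (α : Type*) [Finite α] [PartialOrder α] (k : ℕ) : dk α k ≤ Nat.card α := by
  obtain ⟨C, hC, h⟩ := exists_dk (α := α) k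
  rw [← h]; exact Set.ncard_le_card _

/-- Greene's theorem (min-max form). -/
theorem greene_dual {α : Type*} [Fintype α] [PartialOrder α] (k : ℕ) :
    ∃ (h : ℕ) (A : Fin h → Set α), (∀ i, IsAntichain (· ≤ ·) (A i)) ∧
      k * h + ((⋃ i, A i)ᶜ).ncard ≤ ck α k := by
  classical
  rcases Nat.eq_zero_or_pos k with rfl | hk
  · refine ⟨Fintype.card α, fun i => {(Fintype.equivFin α).symm i}, fun i => by simp, ?_⟩
    have : (⋃ i, {(Fintype.equivFin α).symm i} : Set α) = Set.univ := by
      ext x; simp only [Set.mem_iUnion, Set.mem_singleton_iff, Set.mem_univ, iff_true]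
      exact ⟨Fintype.equivFin α x, by simp⟩
    rw [this]; simp
  have : Nonempty (Fin k) := ⟨⟨0, hk⟩⟩
  let E : α ⊕ Fin k → α ⊕ Fin k → Prop := fun i j =>
    ∀ p q, i = Sum.inl p → j = Sum.inl q → p ≤ q
  let w : α ⊕ Fin k → α ⊕ Fin k → ℤ := fun i j =>
    Sum.elim (fun q => if i = Sum.inl q then 0 else 1) (fun _ => 0) j
  obtain ⟨u, v, hf, σ, hσ⟩ := egervary_perm E w (by
    intro i p q hp hq; rw [hp] at hq; exact (Sum.inl_injective hq).le)
  obtain ⟨s, hs⟩ := Finite.exists_min (fun i : Fin k => u (Sum.inr i))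
  obtain ⟨t, ht⟩ := Finite.exists_min (fun i : Fin k => v (Sum.inr i))
  have f1 : 0 ≤ u (Sum.inr s) + v (Sum.inr t) := hf (Sum.inr s) (Sum.inr t) (by simp [E])
  have f2 : ∀ p, 0 ≤ u (Sum.inl p) + v (Sum.inr t) := fun p =>
    hf (Sum.inl p) (Sum.inr t) (by simp [E])
  have f3 : ∀ p, 1 ≤ u (Sum.inr s) + v (Sum.inl p) := fun p => by
    simpa [w] using hf (Sum.inr s) (Sum.inl p) (by simp [E])
  have f4 : ∀ p, 0 ≤ u (Sum.inl p) + v (Sum.inl p) := fun p => by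
    simpa [w] using hf (Sum.inl p) (Sum.inl p) (by simp [E])
  have f5 : ∀ p q, p < q → 1 ≤ u (Sum.inl p) + v (Sum.inl q) := fun p q hpq => by
    simpa [w, hpq.ne] using hf (Sum.inl p) (Sum.inl q) (by simp [E, hpq.le])
  obtain ⟨h, hh⟩ := Int.eq_ofNat_of_zero_le f1
  refine ⟨h, fun i => {p | u (Sum.inl p) + v (Sum.inl p) = 0 ∧
    u (Sum.inl p) + v (Sum.inr t) = (i : ℕ)}, ?_, ?_⟩
  · rintro i p ⟨hp1, hp2⟩ q ⟨hq1, hq2⟩ hne hle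
    have := f5 p q (lt_of_le_of_ne hle hne)
    omega
  have hcompl : (⋃ i : Fin h, {p | u (Sum.inl p) + v (Sum.inl p) = 0 ∧
      u (Sum.inl p) + v (Sum.inr t) = (i : ℕ)})ᶜ ⊆
      {p | 1 ≤ u (Sum.inl p) + v (Sum.inl p)} := by
    intro p hp
    by_contra hcon
    simp only [Set.mem_ofPred_eq, not_le] at hcon
    apply hp
    have g1 := f2 p
    have g2 := f3 p
    have g3 := f4 p
    obtain ⟨m, hm⟩ := Int.eq_ofNat_of_zero_le g1
    exact Set.mem_iUnion.2 ⟨⟨m, by omega⟩, by omega, hm⟩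
  have hnz : ((({p | 1 ≤ u (Sum.inl p) + v (Sum.inl p)} : Set α).ncard : ℕ) : ℤ) ≤
      ∑ p, (u (Sum.inl p) + v (Sum.inl p)) := by
    rw [Set.ncard_eq_toFinset_card', Finset.card_eq_sum_ones, Set.toFinset_ofPred,
      Finset.sum_filter]
    push_cast
    refine Finset.sum_le_sum fun p _ => ?_
    have := f4 p
    split_ifs <;> omega
  have hdum : (k : ℤ) * h ≤ ∑ i : Fin k, (u (Sum.inr i) + v (Sum.inr i)) := by
    have : ∑ i : Fin k, (h : ℤ) ≤ ∑ i : Fin k, (u (Sum.inr i) + v (Sum.inr i)) := by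
      refine Finset.sum_le_sum fun i _ => ?_
      have := hs i
      have := ht i
      omega
    simpa using this
  let X : Set α := {q | σ.symm (Sum.inl q) ≠ Sum.inl q}
  have hW : ∑ i, (u i + v i) = X.ncard := by
    rw [Finset.sum_add_distrib, ← Equiv.sum_comp σ v, ← Finset.sum_add_distrib]
    rw [← Finset.sum_congr rfl (fun i _ => (hσ i).2)]
    rw [← Equiv.sum_comp σ.symm (fun i => w i (σ i))]
    simp only [Equiv.apply_symm_apply, Fintype.sum_sum_type]
    rw [Set.ncard_eq_toFinset_card', Finset.card_eq_sum_ones, Set.toFinset_ofPred,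
      Finset.sum_filter]
    push_cast
    simp [w]
  let R : α → α → Prop := fun x y => σ (Sum.inl x) = Sum.inl y ∧ x ≠ y
  have hRle : ∀ x y, R x y → x ≤ y := fun x y hxy => (hσ (Sum.inl x)).1 x y rfl hxy.1
  have hRR : ∀ x y, Relation.ReflTransGen R x y → x ≤ y := by
    intro x y hxy
    induction hxy with
    | refl => exact le_rfl
    | tail _ h ih => exact ih.trans (hRle _ _ h)
  have hRu : Relator.RightUnique R := by
    intro a b c hb hc
    exact Sum.inl_injective (hb.1.symm.trans hc.1)
  let C : Fin k → Set α := fun s => {x | ∃ q, σ (Sum.inr s) = Sum.inl q ∧ Relation.ReflTransGen R q x}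
  have hC : ∀ i, IsChain (· ≤ ·) (C i) := by
    rintro i x ⟨q, hq, hx⟩ y ⟨q', hq', hy⟩ _
    obtain rfl : q = q' := Sum.inl_injective (hq.symm.trans hq')
    exact (Relation.ReflTransGen.total_of_right_unique hRu hx hy).imp (hRR _ _) (hRR _ _)
  have hcov : X ⊆ ⋃ i, C i := by
    intro x
    induction x using WellFoundedLT.induction with
    | ind x ih =>
    intro hx
    have hsx : σ (σ.symm (Sum.inl x)) = Sum.inl x := by simp
    rcases hy : σ.symm (Sum.inl x) with y | i
    · rw [hy] at hsx
      have hyx : y ≠ x := by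
        rintro rfl; exact hx hy
      have hR : R y x := ⟨hsx, hyx⟩
      have hyX : y ∈ X := by
        intro h
        rw [Equiv.symm_apply_eq, hsx] at h
        exact hyx (Sum.inl_injective h)
      obtain ⟨i, q, hq, hqy⟩ := Set.mem_iUnion.1 (ih y (lt_of_le_of_ne (hRle _ _ hR) hyx) hyX)
      exact Set.mem_iUnion.2 ⟨i, q, hq, hqy.tail hR⟩
    · rw [hy] at hsx
      exact Set.mem_iUnion.2 ⟨i, x, hsx, .refl⟩
  have hX : X.ncard ≤ ck α k := (Set.ncard_le_ncard hcov (Set.toFinite _)).trans (le_ck C hC)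
  have hc2 := Set.ncard_le_ncard hcompl (Set.toFinite _)
  rw [Fintype.sum_sum_type] at hW
  zify at hX hc2 ⊢
  linarith

theorem ncard_prefix_succ {α : Type*} [Finite α] {n : ℕ} (F : Fin n → Set α)
    (hd : ∀ i j, i ≠ j → Disjoint (F i) (F j)) (j : Fin n) :
    (⋃ i : Fin n, ⋃ (_ : (i : ℕ) < j + 1), F i).ncard =
      (⋃ i : Fin n, ⋃ (_ : (i : ℕ) < j), F i).ncard + (F j).ncard := by
  rw [← Set.ncard_union_eq _ (Set.toFinite _) (Set.toFinite _)]
  · congr 1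
    ext x
    simp only [Set.mem_iUnion, Set.mem_union, exists_prop]
    constructor
    · rintro ⟨i, hi, hx⟩
      rcases Nat.lt_succ_iff_lt_or_eq.1 hi with h | h
      · exact Or.inl ⟨i, h, hx⟩
      · rw [Fin.ext h] at hx; exact Or.inr hx
    · rintro (⟨i, hi, hx⟩ | hx)
      · exact ⟨i, by omega, hx⟩
      · exact ⟨j, by omega, hx⟩
  · simp only [Set.disjoint_iUnion_left]
    intro i hi
    exact hd i j (by rintro rfl; exact lt_irrefl _ hi)

theorem iUnion_prefix_all {α : Type*} {n : ℕ} (F : Fin n → Set α) :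
    (⋃ i : Fin n, ⋃ (_ : (i : ℕ) < n), F i) = ⋃ i, F i := by
  simp

theorem ck_width {α : Type*} [Finite α] [PartialOrder α] (h : CDecomposable α) :
    ck α (widthP α) = Nat.card α := by
  obtain ⟨C, -, -, hu, hk⟩ := h
  rw [← hk _ le_rfl, iUnion_prefix_all, hu, Set.ncard_univ]

theorem dk_height {α : Type*} [Finite α] [PartialOrder α] (h : DDecomposable α) :
    dk α (heightP α) = Nat.card α := by
  obtain ⟨C, -, -, hu, hk⟩ := h
  rw [← hk _ le_rfl, iUnion_prefix_all, hu, Set.ncard_univ]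

theorem ck_of_width_le {α : Type*} [Finite α] [PartialOrder α] (h : CDecomposable α) {k : ℕ}
    (hk : widthP α ≤ k) : ck α k = Nat.card α :=
  le_antisymm (ck_le_card _ _) (ck_width h ▸ ck_mono α hk)

theorem ncard_chain_inter_antichain {α : Type*} [Finite α] [PartialOrder α] {C A : Set α}
    (hC : IsChain (· ≤ ·) C) (hA : IsAntichain (· ≤ ·) A) : (C ∩ A).ncard ≤ 1 := by
  rw [Set.ncard_le_one]
  intro a ha b hb
  by_contra hne
  rcases hC ha.1 hb.1 hne with h | h
  · exact hA ha.2 hb.2 hne h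
  · exact hA hb.2 ha.2 (Ne.symm hne) h

/-- Conjugacy: `c_k = ∑ min(k, μ_j)`. -/
theorem ck_eq_sum_min {α : Type*} [Fintype α] [PartialOrder α] (h : DDecomposable α) (k : ℕ) :
    ck α k = ∑ j ∈ Finset.range (heightP α), min k (dk α (j + 1) - dk α j) := by
  apply le_antisymm
  · obtain ⟨A, hA, hd, hu, hk⟩ := h
    obtain ⟨C, hC, hCk⟩ := exists_ck (α := α) k
    rw [← hCk, ← Fin.sum_univ_eq_sum_range (fun j => min k (dk α (j + 1) - dk α j))]
    have h1 : (⋃ i, C i) = ⋃ j, ((⋃ i, C i) ∩ A j) := by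
      rw [← Set.inter_iUnion, hu, Set.inter_univ]
    rw [h1]
    refine (Set.ncard_iUnion_le_of_fintype _).trans (Finset.sum_le_sum fun j _ => ?_)
    have h2 : dk α (j + 1) - dk α j = (A j).ncard := by
      rw [← hk _ j.2, ← hk _ j.2.le, ncard_prefix_succ A hd j, Nat.add_sub_cancel_left]
    rw [h2]
    refine le_min ?_ (Set.ncard_le_ncard Set.inter_subset_right (Set.toFinite _))
    rw [Set.iUnion_inter]
    refine (Set.ncard_iUnion_le_of_fintype _).trans ?_
    refine (Finset.sum_le_sum fun i _ => ncard_chain_inter_antichain (hC i) (hA j)).trans ?_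
    simp
  · obtain ⟨g, B, hB, hg⟩ := greene_dual (α := α) k
    have h1 := le_dk B hB
    have h2 := Set.ncard_add_ncard_compl (⋃ i, B i)
    refine le_trans ?_ hg
    have hH := dk_height h
    rcases le_total (heightP α) g with hle | hle
    · calc _ ≤ ∑ j ∈ Finset.range (heightP α), k := Finset.sum_le_sum fun _ _ => min_le_left _ _
        _ = heightP α * k := by simp
        _ ≤ k * g := by rw [mul_comm]; exact Nat.mul_le_mul_left _ hle
        _ ≤ _ := Nat.le_add_right _ _
    · have ht : ∀ n, ∑ j ∈ Finset.range n, (dk α (j + 1) - dk α j) = dk α n := by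
        intro n
        rw [Finset.sum_range_tsub (dk_mono α), dk_zero, Nat.sub_zero]
      rw [← Finset.sum_range_add_sum_Ico _ hle]
      have h3 : ∑ j ∈ Finset.range g, min k (dk α (j + 1) - dk α j) ≤ k * g := by
        refine (Finset.sum_le_sum fun _ _ => min_le_left _ _).trans ?_
        simp [mul_comm]
      have h4 : ∑ j ∈ Finset.Ico g (heightP α), min k (dk α (j + 1) - dk α j) ≤
          ∑ j ∈ Finset.Ico g (heightP α), (dk α (j + 1) - dk α j) :=
        Finset.sum_le_sum fun _ _ => min_le_right _ _
      have h5 := Finset.sum_range_add_sum_Ico (fun j => dk α (j + 1) - dk α j) hle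
      rw [ht, ht] at h5
      omega

theorem sum_ck_le {α β : Type*} [Fintype α] [PartialOrder α] [Fintype β] [PartialOrder β]
    (hPc : CDecomposable α) (hPd : DDecomposable α) (hQc : CDecomposable β) :
    ∑ j ∈ Finset.range (heightP α), ck β (dk α (j + 1) - dk α j) ≤
      ∑ i ∈ Finset.range (min (widthP α) (widthP β)),
        (ck α (i + 1) - ck α i) * (ck β (i + 1) - ck β i) := by
  classical
  set a : ℕ → ℕ := fun j => dk α (j + 1) - dk α j with ha
  have haM : ∀ j, a j ≤ Nat.card α := fun j => (Nat.sub_le _ _).trans (dk_le_card α _)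
  have h1 : ∀ j, ck β (a j) = ∑ i ∈ Finset.range (Nat.card α),
      (if i < a j then 1 else 0) * (ck β (i + 1) - ck β i) := by
    intro j
    have := Finset.sum_range_tsub (ck_mono β) (a j)
    rw [ck_zero, Nat.sub_zero] at this
    rw [← this]
    simp only [ite_mul, one_mul, zero_mul]
    rw [← Finset.sum_filter]
    refine Finset.sum_congr ?_ fun _ _ => rfl
    ext i
    have := haM j
    simp only [Finset.mem_range, Finset.mem_filter]
    omega
  have h2 : ∀ i, ∑ j ∈ Finset.range (heightP α), (if i < a j then 1 else 0) =
      ck α (i + 1) - ck α i := by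
    intro i
    rw [ck_eq_sum_min hPd, ck_eq_sum_min hPd]
    apply Nat.eq_sub_of_add_eq
    rw [← Finset.sum_add_distrib]
    refine Finset.sum_congr rfl fun j _ => ?_
    change (if i < a j then 1 else 0) + min i (a j) = min (i + 1) (a j)
    split_ifs <;> omega
  have h3 : ∑ j ∈ Finset.range (heightP α), ck β (a j) =
      ∑ i ∈ Finset.range (Nat.card α), (ck α (i + 1) - ck α i) * (ck β (i + 1) - ck β i) := by
    simp only [h1]
    rw [Finset.sum_comm]
    refine Finset.sum_congr rfl fun i _ => ?_
    rw [← Finset.sum_mul, h2]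
  change ∑ j ∈ Finset.range (heightP α), ck β (a j) ≤ _
  rw [h3]
  rw [← Finset.sum_filter_add_sum_filter_not (Finset.range (Nat.card α))
    (fun i => i < min (widthP α) (widthP β))]
  have h4 : ∑ i ∈ (Finset.range (Nat.card α)).filter
      (fun i => ¬ i < min (widthP α) (widthP β)),
      (ck α (i + 1) - ck α i) * (ck β (i + 1) - ck β i) = 0 := by
    refine Finset.sum_eq_zero fun i hi => ?_
    have hi := (Finset.mem_filter.1 hi).2
    rw [not_lt, min_le_iff] at hi
    rcases hi with hi | hi
    · rw [ck_of_width_le hPc hi, ck_of_width_le hPc (hi.trans (Nat.le_succ i))]; simp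
    · rw [ck_of_width_le hQc hi, ck_of_width_le hQc (hi.trans (Nat.le_succ i))]; simp
  rw [h4, add_zero]
  refine Finset.sum_le_sum_of_subset ?_
  intro i hi
  exact Finset.mem_range.2 (Finset.mem_filter.1 hi).2

theorem le_maxSemichain {α β : Type*} [Fintype α] [PartialOrder α] [Fintype β] [PartialOrder β]
    (hPc : CDecomposable α) (hQc : CDecomposable β) :
    ∑ i ∈ Finset.range (min (widthP α) (widthP β)),
        (ck α (i + 1) - ck α i) * (ck β (i + 1) - ck β i) ≤ maxSemichain α β := by
  obtain ⟨C, hC, hCd, hCu, hCk⟩ := hPc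
  obtain ⟨D, hD, hDd, hDu, hDk⟩ := hQc
  set m := min (widthP α) (widthP β) with hm
  have hma : m ≤ widthP α := min_le_left _ _
  have hmb : m ≤ widthP β := min_le_right _ _
  let T : Fin m → Set (α × β) := fun i => C (i.castLE hma) ×ˢ D (i.castLE hmb)
  have hTd : Pairwise (Function.onFun Disjoint T) := by
    intro i j hij
    rw [Function.onFun, Set.disjoint_left]
    rintro x hx hy
    exact Set.disjoint_left.1 (hCd (i.castLE hma) (j.castLE hma)
      (fun h => hij (Fin.castLE_injective hma h))) hx.1 hy.1
  have hsemi : IsSemichain (⋃ i, T i) := by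
    rintro ⟨p, q⟩ hx ⟨p', q'⟩ hy hne U hU ⟨hxU, hyU⟩
    obtain ⟨i, hi⟩ := Set.mem_iUnion.1 hx
    obtain ⟨j, hj⟩ := Set.mem_iUnion.1 hy
    rcases hU with ⟨r, A, hA, rfl⟩ | ⟨r, A, hA, rfl⟩
    · obtain ⟨h1, h2⟩ := hxU
      obtain ⟨h3, h4⟩ := hyU
      simp only [Set.mem_singleton_iff] at h1 h3
      subst h1; subst h3
      have hij : i = j := by
        by_contra h
        exact Set.disjoint_left.1 (hCd (i.castLE hma) (j.castLE hma)
          (fun h' => h (Fin.castLE_injective hma h'))) hi.1 hj.1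
      subst hij
      have hqq : q ≠ q' := fun h => hne (by rw [h])
      rcases hD _ hi.2 hj.2 hqq with h | h
      · exact hA h2 h4 hqq h
      · exact hA h4 h2 hqq.symm h
    · obtain ⟨h1, h2⟩ := hxU
      obtain ⟨h3, h4⟩ := hyU
      simp only [Set.mem_singleton_iff] at h2 h4
      subst h2; subst h4
      have hij : i = j := by
        by_contra h
        exact Set.disjoint_left.1 (hDd (i.castLE hmb) (j.castLE hmb)
          (fun h' => h (Fin.castLE_injective hmb h'))) hi.2 hj.2
      subst hij
      have hqq : p ≠ p' := fun h => hne (by rw [h])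
      rcases hC _ hi.1 hj.1 hqq with h | h
      · exact hA h1 h3 hqq h
      · exact hA h3 h1 hqq.symm h
  have hcard : (⋃ i, T i).ncard = ∑ i ∈ Finset.range m,
        (ck α (i + 1) - ck α i) * (ck β (i + 1) - ck β i) := by
    rw [Set.ncard_iUnion_of_finite (fun i => Set.toFinite _) hTd, finsum_eq_sum_of_fintype,
      ← Fin.sum_univ_eq_sum_range
        (fun i => (ck α (i + 1) - ck α i) * (ck β (i + 1) - ck β i))]
    refine Finset.sum_congr rfl fun i _ => ?_
    have e1 := ncard_prefix_succ C hCd (i.castLE hma)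
    have e2 := ncard_prefix_succ D hDd (i.castLE hmb)
    simp only [Fin.val_castLE] at e1 e2
    have i1 := i.2
    rw [hCk _ (by omega), hCk _ (by omega)] at e1
    rw [hDk _ (by omega), hDk _ (by omega)] at e2
    rw [e1, e2, Nat.add_sub_cancel_left, Nat.add_sub_cancel_left, Set.ncard_prod]
  rw [← hcard]
  exact le_csSup (bdd_ncard (fun T : Set (α × β) => IsSemichain T) id) ⟨_, hsemi, rfl⟩

theorem maxSemichain_le_card {α β ι : Type*} [Fintype α] [PartialOrder α] [Fintype β]
    [PartialOrder β] [Fintype ι] (U : ι → Set (α × β)) (hU : ∀ i, IsUniantichain (U i))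
    (hc : (⋃ i, U i) = Set.univ) : maxSemichain α β ≤ Fintype.card ι := by
  refine csSup_le' ?_
  rintro n ⟨T, hT, rfl⟩
  have hex : ∀ x : α × β, ∃ i, x ∈ U i := fun x => by
    have : x ∈ ⋃ i, U i := by rw [hc]; trivial
    exact Set.mem_iUnion.1 this
  choose f hf using hex
  rw [← Nat.card_coe_set_eq, ← Nat.card_eq_fintype_card]
  refine Nat.card_le_card_of_injective (fun x : T => f x) ?_
  rintro ⟨x, hx⟩ ⟨y, hy⟩ hxy
  by_contra hne
  refine hT x hx y hy (fun h => hne (Subtype.ext h)) _ (hU (f x)) ⟨hf x, ?_⟩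
  simp only at hxy
  rw [hxy]; exact hf y

theorem minCover_le_card {α β ι : Type*} [PartialOrder α]
    [PartialOrder β] [Fintype ι] (U : ι → Set (α × β)) (hU : ∀ i, IsUniantichain (U i))
    (hc : (⋃ i, U i) = Set.univ) : minUniantichainCover α β ≤ Fintype.card ι := by
  refine Nat.sInf_le ⟨fun i => U ((Fintype.equivFin ι).symm i), fun i => hU _, ?_⟩
  rw [← hc]
  exact (Fintype.equivFin ι).symm.surjective.iUnion_comp U

theorem minCover_le_sum {α β : Type*} [Fintype α] [PartialOrder α] [Fintype β] [PartialOrder β]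
    (hPd : DDecomposable α) :
    maxSemichain α β ≤ minUniantichainCover α β ∧ minUniantichainCover α β ≤
      ∑ j ∈ Finset.range (heightP α), ck β (dk α (j + 1) - dk α j) := by
  classical
  obtain ⟨A, hA, hd, hu, hk⟩ := hPd
  have h2 : ∀ j : Fin (heightP α), dk α (j + 1) - dk α j = (A j).ncard := by
    intro j
    rw [← hk _ j.2, ← hk _ j.2.le, ncard_prefix_succ A hd j, Nat.add_sub_cancel_left]
  choose g B hB hg using fun j : Fin (heightP α) => greene_dual (α := β) (A j).ncard
  let U : (Σ j : Fin (heightP α), (A j × Fin (g j)) ⊕ ((⋃ i, B j i)ᶜ : Set β)) → Set (α × β) :=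
    fun x => Sum.elim (fun y => ({y.1.1} : Set α) ×ˢ B x.1 y.2)
      (fun q => A x.1 ×ˢ ({q.1} : Set β)) x.2
  have hU : ∀ x, IsUniantichain (U x) := by
    rintro ⟨j, y | q⟩
    · exact Or.inl ⟨_, _, hB j y.2, rfl⟩
    · exact Or.inr ⟨_, _, hA j, rfl⟩
  have hc : (⋃ x, U x) = Set.univ := by
    refine Set.eq_univ_of_forall ?_
    rintro ⟨p, q⟩
    have : p ∈ ⋃ j, A j := by rw [hu]; trivial
    obtain ⟨j, hj⟩ := Set.mem_iUnion.1 this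
    by_cases hq : q ∈ ⋃ i, B j i
    · obtain ⟨i, hi⟩ := Set.mem_iUnion.1 hq
      exact Set.mem_iUnion.2 ⟨⟨j, Sum.inl (⟨p, hj⟩, i)⟩, rfl, hi⟩
    · exact Set.mem_iUnion.2 ⟨⟨j, Sum.inr ⟨q, hq⟩⟩, hj, rfl⟩
  constructor
  · refine le_csInf ⟨_, fun i => U ((Fintype.equivFin _).symm i), fun i => hU _, ?_⟩ ?_
    · rw [← hc]
      exact (Fintype.equivFin _).symm.surjective.iUnion_comp U
    · rintro n ⟨V, hV, hVc⟩
      simpa using maxSemichain_le_card V hV hVc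
  · refine (minCover_le_card U hU hc).trans ?_
    rw [← Fin.sum_univ_eq_sum_range (fun j => ck β (dk α (j + 1) - dk α j)), Fintype.card_sigma]
    refine Finset.sum_le_sum fun j _ => ?_
    rw [h2 j]
    refine le_trans (le_of_eq ?_) (hg j)
    rw [Fintype.card_sum, Fintype.card_prod, Fintype.card_fin, ← Nat.card_eq_fintype_card,
      ← Nat.card_eq_fintype_card, Nat.card_coe_set_eq, Nat.card_coe_set_eq]

/-- Dual of Theorem `thm:main`: if `P` is c-decomposable and d-decomposable
and `Q` is c-decomposable, then the maximum size of a semichain in `P × Q`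
equals the minimum number of uniantichains needed to cover `P × Q`, and this
common value is
`∑_{i=1}^{min(w(P),w(Q))} λ_i^P λ_i^Q = ∑_{j=1}^{h(P)} c_{μ_j^P}(Q)`,
where `λ_i = c_i - c_{i-1}` and `μ_j = d_j - d_{j-1}`. -/
theorem semichain_uniantichain_duality_of_decomposable
    (α β : Type) [Fintype α] [PartialOrder α] [Fintype β] [PartialOrder β]
    (hPc : CDecomposable α) (hPd : DDecomposable α) (hQc : CDecomposable β) :
    maxSemichain α β = minUniantichainCover α β ∧
    maxSemichain α β =
      ∑ i ∈ Finset.range (min (widthP α) (widthP β)),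
        (ck α (i + 1) - ck α i) * (ck β (i + 1) - ck β i) ∧
    maxSemichain α β =
      ∑ j ∈ Finset.range (heightP α), ck β (dk α (j + 1) - dk α j) := by

  have h1 := le_maxSemichain hPc hQc
  have h2 := sum_ck_le hPc hPd hQc
  obtain ⟨h3, h4⟩ := minCover_le_sum (β := β) hPd
  refine ⟨?_, ?_, ?_⟩ <;> omega
end
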